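/- arXiv:1202.4032 — 4 statements merged into one kernel-verified Lean document; each statement's English description precedes it below -/
import Mathlib

section
/- If G is a finite simple graph with girth at least 9, then the b-chromatic number of G is at least m(G) - 1. -/
open SimpleGraph Finset

/-- A vertex `u` is a b-vertex for the coloring `C` if `u` has a neighbor colored
with each color different from its own. -/
def IsBVertex {V : Type*} (G : SimpleGraph V) {k : ℕ} (C : V → Fin k) (u : V) : Prop :=
  ∀ j : Fin k, j ≠ C u → ∃ w, G.Adj u w ∧ C w = j

/-- A b-coloring of `G` with `k` colors: a proper coloring with colors `Fin k` such that
every color class contains a b-vertex (in particular every color is used). -/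
def IsBColoring {V : Type*} (G : SimpleGraph V) (k : ℕ) (C : V → Fin k) : Prop :=
  (∀ u v, G.Adj u v → C u ≠ C v) ∧
  (∀ i : Fin k, ∃ u, C u = i ∧ IsBVertex G C u)

/-- The b-chromatic number: the largest `k` such that `G` has a b-coloring with `k` colors. -/
noncomputable def bChromatic {V : Type*} (G : SimpleGraph V) : ℕ :=
  sSup {k : ℕ | ∃ C : V → Fin k, IsBColoring G k C}

/-- `m(G)`: the largest `k` such that `G` has at least `k` vertices of degree at least `k - 1`. -/
noncomputable def mParam {V : Type*} [Fintype V] (G : SimpleGraph V) [DecidableRel G.Adj] : ℕ :=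
  sSup {k : ℕ | k ≤ (Finset.univ.filter fun v => k - 1 ≤ G.degree v).card}

/-- The set `M(G)` of dense vertices, i.e. vertices of degree at least `m(G) - 1`. -/
noncomputable def denseSet {V : Type*} [Fintype V] (G : SimpleGraph V) [DecidableRel G.Adj] :
    Finset V :=
  Finset.univ.filter fun v => mParam G - 1 ≤ G.degree v

/-- `W` encircles `u` if every `v ∈ W` is adjacent to `u` or has a common neighbor
`w ∈ W` with `u` such that `deg w = m(G) - 1`. -/
def Encircles {V : Type*} [Fintype V] (G : SimpleGraph V) [DecidableRel G.Adj]
    (W : Finset V) (u : V) : Prop :=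
  ∀ v ∈ W, G.Adj u v ∨ ∃ w ∈ W, G.Adj v w ∧ G.Adj u w ∧ G.degree w = mParam G - 1

/-- A good set: a set `W ⊆ M(G)` of `m(G)` vertices that encircles no vertex outside `W`,
and such that every vertex outside `W` of degree at least `m(G)` has a neighbor in `W`. -/
def IsGoodSet {V : Type*} [Fintype V] (G : SimpleGraph V) [DecidableRel G.Adj]
    (W : Finset V) : Prop :=
  W.card = mParam G ∧
  (∀ v ∈ W, mParam G - 1 ≤ G.degree v) ∧
  (∀ u, u ∉ W → ¬ Encircles G W u) ∧
  (∀ x, x ∉ W → mParam G ≤ G.degree x → ∃ w ∈ W, G.Adj x w)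

theorem eq_of_isPath_of_length_add_le {V : Type*} {G : SimpleGraph V} (hg : 9 ≤ G.egirth) {a b : V}
    {p q : G.Walk a b} (hp : p.IsPath) (hq : q.IsPath) (h : p.length + q.length ≤ 8) :
    p = q := by
  classical
  let E : Finset (Sym2 V) := p.edges.toFinset ∪ q.edges.toFinset
  let K : SimpleGraph V := SimpleGraph.fromEdgeSet (E : Set (Sym2 V))
  have hE : ∀ e ∈ E, e ∈ G.edgeSet := by
    intro e he
    rcases Finset.mem_union.1 he with he | he
    · exact p.edges_subset_edgeSet (List.mem_toFinset.1 he)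
    · exact q.edges_subset_edgeSet (List.mem_toFinset.1 he)
  have hEK : ∀ e ∈ E, e ∈ K.edgeSet := fun e he => by
    rw [SimpleGraph.edgeSet_fromEdgeSet]
    exact ⟨he, fun hd => G.not_isDiag_of_mem_edgeSet (hE e he) hd⟩
  have hKG : K ≤ G := by
    intro x y hxy
    exact hE _ ((SimpleGraph.fromEdgeSet_adj _).1 hxy).1
  have hcard : E.card ≤ 8 := by
    refine (Finset.card_union_le _ _).trans ?_
    have h1 := List.toFinset_card_le p.edges
    have h2 := List.toFinset_card_le q.edges
    rw [SimpleGraph.Walk.length_edges] at h1 h2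
    omega
  have hac : K.IsAcyclic := by
    intro x c hc
    have h1 := SimpleGraph.le_egirth.1 hg x (c.mapLe hKG) ((SimpleGraph.Walk.isCycle_mapLe hKG).2 hc)
    have h2 : c.edges.toFinset ⊆ E := by
      intro e he
      have := c.edges_subset_edgeSet (List.mem_toFinset.1 he)
      rw [SimpleGraph.edgeSet_fromEdgeSet] at this
      exact this.1
    have h3 := Finset.card_le_card h2
    rw [List.toFinset_card_of_nodup hc.edges_nodup, SimpleGraph.Walk.length_edges] at h3
    have h4 : (9 : ℕ∞) ≤ (c.length : ℕ∞) := by simpa using h1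
    have h5 : 9 ≤ c.length := by exact_mod_cast h4
    omega
  have hpK : ∀ e ∈ p.edges, e ∈ K.edgeSet := fun e he =>
    hEK e (Finset.mem_union_left _ (List.mem_toFinset.2 he))
  have hqK : ∀ e ∈ q.edges, e ∈ K.edgeSet := fun e he =>
    hEK e (Finset.mem_union_right _ (List.mem_toFinset.2 he))
  have huniq := (hac.subsingleton_path a b).elim
    ⟨p.transfer K hpK, hp.transfer hpK⟩ ⟨q.transfer K hqK, hq.transfer hqK⟩
  have hsup := congrArg SimpleGraph.Walk.support (congrArg Subtype.val huniq)
  simp only [SimpleGraph.Walk.support_transfer] at hsup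
  exact SimpleGraph.Walk.ext_support hsup

/-- In a graph of girth at least nine, two lists of vertices that trace out paths from `z` to the
same vertex and have at most eight edges in total are equal. -/
theorem path_list_unique {V : Type*} {G : SimpleGraph V} (hg : 9 ≤ G.egirth) {z : V} {l₁ l₂ : List V}
    (c₁ : List.IsChain G.Adj (z :: l₁)) (c₂ : List.IsChain G.Adj (z :: l₂))
    (n₁ : (z :: l₁).Nodup) (n₂ : (z :: l₂).Nodup)
    (hlast : (z :: l₁).getLast (by simp) = (z :: l₂).getLast (by simp))
    (hlen : l₁.length + l₂.length ≤ 8) : l₁ = l₂ := by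
  let p : G.Walk z ((z :: l₁).getLast (by simp)) :=
    (SimpleGraph.Walk.ofSupport (z :: l₁) (by simp) c₁).copy (by simp) rfl
  let q : G.Walk z ((z :: l₁).getLast (by simp)) :=
    (SimpleGraph.Walk.ofSupport (z :: l₂) (by simp) c₂).copy (by simp) hlast.symm
  have hp : p.support = z :: l₁ :=
    (SimpleGraph.Walk.support_copy _ _ _).trans (SimpleGraph.Walk.support_ofSupport _ _)
  have hq : q.support = z :: l₂ :=
    (SimpleGraph.Walk.support_copy _ _ _).trans (SimpleGraph.Walk.support_ofSupport _ _)
  have h1 : p.length = l₁.length := by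
    have := p.length_support; rw [hp, List.length_cons] at this; omega
  have h2 : q.length = l₂.length := by
    have := q.length_support; rw [hq, List.length_cons] at this; omega
  have := eq_of_isPath_of_length_add_le hg (p := p) (q := q) ((SimpleGraph.Walk.isPath_def _).2 (by rw [hp]; exact n₁))
    ((SimpleGraph.Walk.isPath_def _).2 (by rw [hq]; exact n₂)) (by omega)
  rw [this, hq] at hp
  exact (List.cons.inj hp).2.symm

/-- Hall's theorem for bijections avoiding few forbidden pairs. -/
theorem exists_injOn_avoiding {α β : Type*} [DecidableEq α] [DecidableEq β]
    (R : Finset α) (U : Finset β) (F : β → Finset α) (h1 : R.card ≤ U.card)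
    (h2 : ∑ x ∈ U, (F x).card ≤ U.card)
    (h3 : ∑ x ∈ U, (F x).card < U.card ∨
      ∃ x ∈ U, ∃ y ∈ U, x ≠ y ∧ ∃ a ∈ F x, ∃ b ∈ F y, a ≠ b) :
    ∃ g : α → β, Set.InjOn g R ∧ ∀ r ∈ R, g r ∈ U ∧ r ∉ F (g r) := by
  let t : R → Finset β := fun r => U.filter fun x => (r : α) ∉ F x
  have key : ∃ g : R → β, Function.Injective g ∧ ∀ r, g r ∈ t r := by
    rw [← Finset.all_card_le_biUnion_card_iff_exists_injective]
    intro s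
    rcases s.eq_empty_or_nonempty with rfl | ⟨r₀, hr₀⟩
    · simp
    let T : Finset α := s.map (Function.Embedding.subtype _)
    let Q : Finset β := U.filter fun x => T ⊆ F x
    have hT : T.card = s.card := Finset.card_map _
    have hTR : T.card ≤ R.card := Finset.card_le_card (by
      intro a ha
      obtain ⟨r, -, rfl⟩ := Finset.mem_map.1 ha
      exact r.2)
    have hQ : U \ Q ⊆ s.biUnion t := by
      intro x hx
      obtain ⟨hxU, hxQ⟩ := Finset.mem_sdiff.1 hx
      have : ¬ T ⊆ F x := fun h => hxQ (Finset.mem_filter.2 ⟨hxU, h⟩)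
      obtain ⟨a, ha, haF⟩ := Finset.not_subset.1 this
      obtain ⟨r, hr, rfl⟩ := Finset.mem_map.1 ha
      exact Finset.mem_biUnion.2 ⟨r, hr, Finset.mem_filter.2 ⟨hxU, haF⟩⟩
    have hQU : Q ⊆ U := Finset.filter_subset _ _
    have hcardQ := Finset.card_sdiff_add_card_eq_card hQU
    have hle := Finset.card_le_card hQ
    suffices hsuff : T.card + Q.card ≤ U.card by omega
    have hTpos : 0 < T.card := by rw [hT]; exact Finset.card_pos.2 ⟨r₀, hr₀⟩
    have hQmul : Q.card * T.card ≤ ∑ x ∈ Q, (F x).card := by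
      rw [← smul_eq_mul]
      exact Finset.card_nsmul_le_sum _ _ _ fun x hx =>
        Finset.card_le_card (Finset.mem_filter.1 hx).2
    have hQsum : ∑ x ∈ Q, (F x).card ≤ ∑ x ∈ U, (F x).card :=
      Finset.sum_le_sum_of_subset hQU
    by_contra hcon
    have hQpos : 0 < Q.card := by omega
    rcases h3 with h3 | ⟨x, hx, y, hy, hxy, a, ha, b, hb, hab⟩
    · have : T.card + Q.card ≤ Q.card * T.card + 1 := by nlinarith
      omega
    · have hone : T.card = 1 ∨ Q.card = 1 := by
        by_contra hne
        push Not at hne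
        have h4 : 2 ≤ T.card := by omega
        have h5 : 2 ≤ Q.card := by omega
        have : T.card + Q.card ≤ Q.card * T.card := by nlinarith
        omega
      rcases hone with hone | hone
      · obtain ⟨c, hc⟩ := Finset.card_eq_one.1 hone
        have hQeq : Q = U := Finset.eq_of_subset_of_card_le hQU (by omega)
        have hcF : ∀ w ∈ U, c ∈ F w := by
          intro w hw
          rw [← hQeq] at hw
          exact (Finset.mem_filter.1 hw).2 (by simp [hc])
        have haux : ∃ w ∈ U, ∃ e ∈ F w, e ≠ c := by
          by_cases hac : a = c
          · exact ⟨y, hy, b, hb, fun h => hab (hac.trans h.symm)⟩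
          · exact ⟨x, hx, a, ha, hac⟩
        obtain ⟨w, hw, e, he, hec⟩ := haux
        have : ∑ w ∈ U, 1 < ∑ w ∈ U, (F w).card :=
          Finset.sum_lt_sum (fun w hw => Finset.card_pos.2 ⟨c, hcF w hw⟩)
            ⟨w, hw, Finset.one_lt_card.2 ⟨e, he, c, hcF w hw, hec⟩⟩
        simp at this
        omega
      · obtain ⟨w, hw⟩ := Finset.card_eq_one.1 hone
        have hwU : w ∈ U := hQU (by simp [hw])
        have hwF : T.card ≤ (F w).card :=
          Finset.card_le_card (Finset.mem_filter.1 (show w ∈ Q by simp [hw])).2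
        have haux : ∃ v ∈ U, v ≠ w ∧ 0 < (F v).card := by
          by_cases hxw : x = w
          · exact ⟨y, hy, fun h => hxy (hxw.trans h.symm), Finset.card_pos.2 ⟨b, hb⟩⟩
          · exact ⟨x, hx, hxw, Finset.card_pos.2 ⟨a, ha⟩⟩
        obtain ⟨v, hv, hvw, hvF⟩ := haux
        have : ∑ x ∈ ({v, w} : Finset β), (F x).card ≤ ∑ x ∈ U, (F x).card :=
          Finset.sum_le_sum_of_subset (by
            intro u hu
            rcases Finset.mem_insert.1 hu with rfl | hu
            · exact hv
            · rw [Finset.mem_singleton.1 hu]; exact hwU)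
        rw [Finset.sum_pair hvw] at this
        omega
  obtain ⟨g, hg, hgt⟩ := key
  rcases R.eq_empty_or_nonempty with rfl | ⟨r₀, hr₀⟩
  · by_cases hβ : Nonempty β
    · exact ⟨fun _ => hβ.some, by simp, by simp⟩
    · rcases h3 with h3 | ⟨x, -⟩
      · exact absurd (Finset.card_pos.1 (by omega : 0 < U.card)) (fun ⟨x, _⟩ => hβ ⟨x⟩)
      · exact absurd ⟨x⟩ hβ
  · refine ⟨fun r => if h : r ∈ R then g ⟨r, h⟩ else g ⟨r₀, hr₀⟩, ?_, ?_⟩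
    · intro r hr r' hr' h
      have hr1 : r ∈ R := hr
      have hr2 : r' ∈ R := hr'
      simp only [hr1, hr2, dite_true] at h
      exact congrArg Subtype.val (hg h)
    · intro r hr
      simp only [hr, dite_true]
      exact Finset.mem_filter.1 (hgt ⟨r, hr⟩)

/-- A partial proper coloring of `G` in which the vertices of `X` carry the colors prescribed by
`φ`, every vertex of `S ⊆ X` already sees all the other colors, and no vertex of `X` outside `S`
has two neighbors of the same color. -/
structure PartialBColoring {V : Type*} (G : SimpleGraph V) {N : ℕ} (X : Finset V) (φ : V → Fin N)
    (S : Finset V) (f : V → Option (Fin N)) : Prop where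
  subset : S ⊆ X
  apply_mem : ∀ w ∈ X, f w = some (φ w)
  proper : ∀ u v, G.Adj u v → ∀ c, f u = some c → f v ≠ some c
  inj : ∀ z ∈ X, z ∉ S → ∀ x y, G.Adj z x → G.Adj z y → ∀ c, f x = some c → f y = some c → x = y
  near : ∀ y c, f y = some c → y ∈ X ∨ ∃ s ∈ S, G.Adj y s
  sees : ∀ z ∈ S, ∀ c, c ≠ φ z → ∃ y, G.Adj z y ∧ f y = some c

/-- The color of the colored vertex `y` restricts the choice of colors at the neighbor `x` of `z`
(or is the color of `x` itself), and `j ∈ X` accounts for the color of `y`. -/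
def Charge {V : Type*} (G : SimpleGraph V) {N : ℕ} (X S : Finset V) (f : V → Option (Fin N))
    (z x y j : V) : Prop :=
  G.Adj z x ∧ y ≠ z ∧ f y ≠ none ∧ ((y ∈ X ∧ j = y) ∨ (y ∉ X ∧ j ∈ S ∧ G.Adj y j)) ∧
    (y = x ∨ (f x = none ∧
      (G.Adj x y ∨ ∃ u ∈ X, u ∉ S ∧ u ≠ z ∧ G.Adj x u ∧ G.Adj u y)))

/-- A sufficient condition for the vertex `z` of degree at least `N - 1` to become a b-vertex by
coloring some of its neighbors. -/
def Processable {V : Type*} [Fintype V] (G : SimpleGraph V) [DecidableRel G.Adj] {N : ℕ}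
    (X S : Finset V) (f : V → Option (Fin N)) (z : V) : Prop :=
  N ≤ G.degree z ∨ (∀ x, G.Adj z x → f x ≠ none) ∨
    (∃ j ∈ X, j ≠ z ∧ ∀ x y, ¬ Charge G X S f z x y j) ∨
    ∃ x x' a b, x ≠ x' ∧ a ≠ b ∧ G.Adj z x ∧ G.Adj z x' ∧ f x = none ∧ f x' = none ∧
      a ∈ X ∧ b ∈ X ∧ a ≠ z ∧ b ≠ z ∧ G.Adj x a ∧ G.Adj x' b

section

variable {V : Type*} {G : SimpleGraph V} {N : ℕ} {X S : Finset V} {φ : V → Fin N}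
  {f : V → Option (Fin N)} {z : V}

theorem PartialBColoring.initial [DecidableEq V] (X : Finset V) (hφ : Set.InjOn φ X) :
    PartialBColoring G X φ ∅ (fun v => if v ∈ X then some (φ v) else none) where
  subset := by simp
  apply_mem w hw := by simp [hw]
  proper u v huv c hu hv := by
    simp only [Option.ite_none_right_eq_some, Option.some.injEq] at hu hv
    exact huv.ne (hφ hu.1 hv.1 (hu.2.trans hv.2.symm))
  inj z _ _ x y _ _ c hx hy := by
    simp only [Option.ite_none_right_eq_some, Option.some.injEq] at hx hy
    exact hφ hx.1 hy.1 (hx.2.trans hy.2.symm)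
  near y c hy := by
    simp only [Option.ite_none_right_eq_some] at hy
    exact Or.inl hy.1
  sees := by simp

theorem PartialBColoring.not_mem_of_eq_none (h : PartialBColoring G X φ S f) {x : V}
    (hx : f x = none) : x ∉ X := fun hX => by
  rw [h.apply_mem x hX] at hx
  exact absurd hx (by simp)

theorem Charge.mem (h : PartialBColoring G X φ S f) {x y j : V} (hc : Charge G X S f z x y j) :
    j ∈ X := by
  obtain ⟨-, -, -, ⟨h1, rfl⟩ | ⟨-, h1, -⟩, -⟩ := hc
  · exact h1
  · exact h.subset h1

theorem Charge.ne (hzS : z ∉ S) {x y j : V} (hc : Charge G X S f z x y j) : j ≠ z := by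
  obtain ⟨-, h0, -, ⟨h1, rfl⟩ | ⟨-, h1, -⟩, -⟩ := hc
  · exact h0
  · rintro rfl
    exact hzS h1

/-- The path from `z` to `j` that is recorded by a charge. -/
theorem Charge.exists_path (h : PartialBColoring G X φ S f) (hzS : z ∉ S)
    {x y j : V} (hc : Charge G X S f z x y j) :
    ∃ l : List V, List.IsChain G.Adj (z :: l) ∧ (z :: l).Nodup ∧
      (z :: l).getLast (by simp) = j ∧ l.length ≤ 4 ∧
      ((l = [x] ∧ y = x ∧ y ∈ X) ∨ (l = [x, j] ∧ y = x ∧ y ∉ X) ∨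
        (f x = none ∧ ((l = [x, y] ∧ y ∈ X) ∨ (l = [x, y, j] ∧ y ∉ X) ∨
          ∃ u ∈ X, u ∉ S ∧ ((l = [x, u, y] ∧ y ∈ X) ∨ (l = [x, u, y, j] ∧ y ∉ X))))) := by
  have hjz := hc.ne hzS
  have hxX := @PartialBColoring.not_mem_of_eq_none _ _ _ _ _ _ _ h
  obtain ⟨hzx, hyz, hy, hj, hxy⟩ := hc
  have hzx' := hzx.ne
  rcases hxy with rfl | ⟨hx, hxy | ⟨u, huX, huS, huz, hxu, huy⟩⟩ <;>
    rcases hj with ⟨hyX, rfl⟩ | ⟨hyX, hjS, hyj⟩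
  · exact ⟨[j], by simp [hzx], by simp [hzx'], by simp, by simp, by simp [hyX]⟩
  · have := hyj.ne
    exact ⟨[y, j], by simp [hzx, hyj], by grind, by simp, by simp, by simp [hyX]⟩
  · have := hxy.ne
    exact ⟨[x, j], by simp [hzx, hxy], by grind, by simp, by simp, by simp [hyX, hx]⟩
  · have h1 := hxy.ne
    have h2 := hyj.ne
    have h3 : x ≠ j := fun e => hxX hx (e ▸ h.subset hjS)
    exact ⟨[x, y, j], by simp [hzx, hxy, hyj], by grind, by simp, by simp, by simp [hyX, hx]⟩
  · have h1 := hxu.ne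
    have h2 := huy.ne
    have h3 : x ≠ j := fun e => hxX hx (e ▸ hyX)
    exact ⟨[x, u, j], by simp [hzx, hxu, huy], by grind, by simp, by simp, by grind⟩
  · have h1 := hxu.ne
    have h2 := huy.ne
    have h4 := hyj.ne
    have h3 : x ≠ j := fun e => hxX hx (e ▸ h.subset hjS)
    have h5 : x ≠ y := fun e => hy (e ▸ hx)
    have h6 : u ≠ j := fun e => huS (e ▸ hjS)
    exact ⟨[x, u, y, j], by simp [hzx, hxu, huy, hyj], by grind, by simp, by simp, by grind⟩

/-- A vertex `j` is charged at most once from `z`. -/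
theorem Charge.unique (hg : 9 ≤ G.egirth) (h : PartialBColoring G X φ S f)
    (hzS : z ∉ S) {x y x' y' j : V} (hc : Charge G X S f z x y j)
    (hc' : Charge G X S f z x' y' j) : x = x' ∧ y = y' := by
  have hy := hc.2.2.1
  have hy' := hc'.2.2.1
  obtain ⟨l, h1, h2, h3, hl, h4⟩ := hc.exists_path h hzS
  obtain ⟨l', h1', h2', h3', hl', h4'⟩ := hc'.exists_path h hzS
  obtain rfl := path_list_unique hg h1 h1' h2 h2' (h3.trans h3'.symm) (by omega)
  clear h1 h2 h3 h1' h2' h3' hl hl'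
  rcases h4 with ⟨rfl, ha, hb⟩ | ⟨rfl, ha, hb⟩ | ⟨hx, ⟨rfl, ha⟩ | ⟨rfl, ha⟩ |
      ⟨u, hu, hus, ⟨rfl, ha⟩ | ⟨rfl, ha⟩⟩⟩ <;> grind

/-- If `j` is charged from `z` and a short path from `z` to `j` starts at a colored neighbor `p`
of `z`, then either `j = p`, or `p ∉ X` and the path has length two. -/
theorem Charge.eq_of_path (hg : 9 ≤ G.egirth) (h : PartialBColoring G X φ S f)
    (hzS : z ∉ S) {x y j p : V} {l : List V} (hc : Charge G X S f z x y j) (hp : f p ≠ none)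
    (h1 : List.IsChain G.Adj (z :: p :: l)) (h2 : (z :: p :: l).Nodup)
    (h3 : (z :: p :: l).getLast (by simp) = j) (h4 : l.length ≤ 3) :
    l = [] ∨ (p ∉ X ∧ l = [j] ∧ j ∈ S) := by
  have hS : p ∉ X → y = p → j ∈ S := by
    rintro hpX rfl
    obtain ⟨-, -, -, ⟨hX, -⟩ | ⟨-, hj, -⟩, -⟩ := hc
    · exact absurd hX hpX
    · exact hj
  obtain ⟨l', h1', h2', h3', hl', h4'⟩ := hc.exists_path h hzS
  obtain rfl := path_list_unique hg h1 h1' h2 h2' (h3.trans h3'.symm) (by simp; omega)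
  clear h1 h2 h3 h1' h2' h3' hl' h4
  rcases h4' with ⟨e, ha, hb⟩ | ⟨e, ha, hb⟩ | ⟨hx, ⟨e, ha⟩ | ⟨e, ha⟩ |
      ⟨u, hu, hus, ⟨e, ha⟩ | ⟨e, ha⟩⟩⟩ <;>
    simp only [List.cons.injEq] at e <;> obtain ⟨rfl, rfl⟩ := e <;> simp_all

theorem PartialBColoring.step [Fintype V] [DecidableEq V] [DecidableRel G.Adj]
    (hg : 9 ≤ G.egirth) (hφ : Set.InjOn φ X) (hX : X.card = N) (h : PartialBColoring G X φ S f)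
    (hz : z ∈ X) (hzS : z ∉ S) (hdeg : N ≤ G.degree z + 1)
    (hcond : Processable G X S f z) :
    ∃ f', PartialBColoring G X φ (insert z S) f' ∧ ∀ v c, f v = some c → f' v = some c := by
  classical
  let A : Finset V := (G.neighborFinset z).filter fun x => f x ≠ none
  let U : Finset V := (G.neighborFinset z).filter fun x => ¬ f x ≠ none
  have hAU : A.card + U.card = G.degree z :=
    Finset.card_filter_add_card_filter_not (s := G.neighborFinset z) (fun x => f x ≠ none)
  have hA : ∀ x, x ∈ A ↔ G.Adj z x ∧ f x ≠ none := by simp [A]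
  have hU : ∀ x, x ∈ U ↔ G.Adj z x ∧ f x = none := by simp [U]
  let B : Finset (Fin N) := A.image fun x => (f x).getD (φ z)
  have hB : ∀ c, c ∈ B ↔ ∃ x, G.Adj z x ∧ f x = some c := by
    intro c
    constructor
    · intro hc
      obtain ⟨x, hx, rfl⟩ := Finset.mem_image.1 hc
      obtain ⟨hzx, hfx⟩ := (hA x).1 hx
      obtain ⟨d, hd⟩ := Option.ne_none_iff_exists'.1 hfx
      exact ⟨x, hzx, by simp [hd]⟩
    · rintro ⟨x, hzx, hfx⟩
      exact Finset.mem_image.2 ⟨x, (hA x).2 ⟨hzx, by simp [hfx]⟩, by simp [hfx]⟩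
  have hBcard : B.card = A.card := by
    refine Finset.card_image_of_injOn ?_
    intro x hx y hy hxy
    obtain ⟨hzx, hfx⟩ := (hA x).1 hx
    obtain ⟨hzy, hfy⟩ := (hA y).1 hy
    obtain ⟨c, hc⟩ := Option.ne_none_iff_exists'.1 hfx
    obtain ⟨d, hd⟩ := Option.ne_none_iff_exists'.1 hfy
    simp only [hc, hd, Option.getD_some] at hxy
    exact h.inj z hz hzS x y hzx hzy c hc (hxy ▸ hd)
  have hzB : φ z ∉ B := fun hb => by
    obtain ⟨x, hzx, hfx⟩ := (hB _).1 hb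
    exact h.proper z x hzx _ (h.apply_mem z hz) hfx
  let R : Finset (Fin N) := (insert (φ z) B)ᶜ
  have hRcard : R.card + A.card + 1 = N := by
    have h1 := Finset.card_add_card_compl (insert (φ z) B)
    rw [Finset.card_insert_of_notMem hzB, hBcard, Fintype.card_fin] at h1
    simp only [R]
    omega
  have hR : ∀ c, c ∈ R ↔ c ≠ φ z ∧ c ∉ B := by simp [R]
  let F : V → Finset (Fin N) := fun x => Finset.univ.filter fun r =>
    ∃ y, y ≠ z ∧ f y = some r ∧ (G.Adj x y ∨ ∃ u ∈ X, u ∉ S ∧ u ≠ z ∧ G.Adj x u ∧ G.Adj u y)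
  have hF : ∀ x r, r ∈ F x ↔ ∃ y, y ≠ z ∧ f y = some r ∧
      (G.Adj x y ∨ ∃ u ∈ X, u ∉ S ∧ u ≠ z ∧ G.Adj x u ∧ G.Adj u y) := by simp [F]
  let C : V → Finset V := fun x => Finset.univ.filter fun j => ∃ y, Charge G X S f z x y j
  have hC : ∀ x j, j ∈ C x ↔ ∃ y, Charge G X S f z x y j := by simp [C]
  have hend : ∀ y c, f y = some c → ∃ j, (y ∈ X ∧ j = y) ∨ (y ∉ X ∧ j ∈ S ∧ G.Adj y j) := by
    intro y c hy
    by_cases hyX : y ∈ X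
    · exact ⟨y, Or.inl ⟨hyX, rfl⟩⟩
    · obtain hy' | ⟨s, hs, hys⟩ := h.near y c hy
      · exact absurd hy' hyX
      · exact ⟨s, Or.inr ⟨hyX, hs, hys⟩⟩
  have hFC : ∀ x ∈ U, (F x).card ≤ (C x).card := by
    intro x hx
    obtain ⟨hzx, hfx⟩ := (hU x).1 hx
    refine Finset.card_le_card_of_forall_subsingleton
      (fun r j => ∃ y, f y = some r ∧ Charge G X S f z x y j) ?_ ?_
    · intro r hr
      obtain ⟨y, hyz, hyr, hxy⟩ := (hF x r).1 hr
      obtain ⟨j, hj⟩ := hend y r hyr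
      have : Charge G X S f z x y j := ⟨hzx, hyz, by simp [hyr], hj, Or.inr ⟨hfx, hxy⟩⟩
      exact ⟨j, (hC x j).2 ⟨y, this⟩, y, hyr, this⟩
    · rintro j - r ⟨-, y, hy, hc⟩ r' ⟨-, y', hy', hc'⟩
      obtain ⟨-, rfl⟩ := hc.unique hg h hzS hc'
      rw [hy] at hy'
      exact Option.some.inj hy'
  have hAC : ∀ x ∈ A, 1 ≤ (C x).card := by
    intro x hx
    obtain ⟨hzx, hfx⟩ := (hA x).1 hx
    obtain ⟨c, hc⟩ := Option.ne_none_iff_exists'.1 hfx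
    obtain ⟨j, hj⟩ := hend x c hc
    exact Finset.card_pos.2 ⟨j, (hC x j).2 ⟨x, hzx, hzx.ne', hfx, hj, Or.inl rfl⟩⟩
  have hdisj : ((G.neighborFinset z : Finset V) : Set V).PairwiseDisjoint C := by
    intro x _ x' _ hne
    refine Finset.disjoint_left.2 fun j hj hj' => hne ?_
    obtain ⟨y, hy⟩ := (hC x j).1 hj
    obtain ⟨y', hy'⟩ := (hC x' j).1 hj'
    exact (hy.unique hg h hzS hy').1
  have hsum : ((G.neighborFinset z).biUnion C).card = ∑ x ∈ A, (C x).card + ∑ x ∈ U, (C x).card := by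
    rw [Finset.card_biUnion hdisj]
    exact (Finset.sum_filter_add_sum_filter_not _ _ _).symm
  have hsub : (G.neighborFinset z).biUnion C ⊆ X.erase z := by
    intro j hj
    obtain ⟨x, -, hx⟩ := Finset.mem_biUnion.1 hj
    obtain ⟨y, hy⟩ := (hC x j).1 hx
    exact Finset.mem_erase.2 ⟨hy.ne hzS, hy.mem h⟩
  have hXz : (X.erase z).card + 1 = N := by rw [Finset.card_erase_add_one hz, hX]
  have hle := Finset.card_le_card hsub
  have hsumU : ∑ x ∈ U, (F x).card ≤ ∑ x ∈ U, (C x).card := Finset.sum_le_sum hFC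
  have hsumA : A.card ≤ ∑ x ∈ A, (C x).card := by
    simpa using Finset.card_nsmul_le_sum A (fun x => (C x).card) 1 hAC
  have key : ∃ g : Fin N → V, Set.InjOn g R ∧ ∀ r ∈ R, g r ∈ U ∧ r ∉ F (g r) := by
    by_cases hall : ∀ x, G.Adj z x → f x ≠ none
    · have hU0 : U = ∅ := Finset.eq_empty_of_forall_notMem fun x hx =>
        hall x ((hU x).1 hx).1 ((hU x).1 hx).2
      have hR0 : R = ∅ := by
        rw [← Finset.card_eq_zero]
        rw [hU0, Finset.card_empty] at hAU
        omega
      exact ⟨fun _ => z, by simp [hR0], by simp [hR0]⟩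
    refine exists_injOn_avoiding R U F (by omega) (by omega) ?_
    rcases hcond with hcond | hcond | ⟨j, hjX, hjz, hj⟩ |
      ⟨x, x', a, b, hxx', hab, hzx, hzx', hfx, hfx', haX, hbX, haz, hbz, hxa, hxb⟩
    · left
      omega
    · exact absurd hcond hall
    · left
      have hlt : ((G.neighborFinset z).biUnion C).card < (X.erase z).card := by
        refine Finset.card_lt_card (Finset.ssubset_iff_of_subset hsub |>.2
          ⟨j, Finset.mem_erase.2 ⟨hjz, hjX⟩, fun hj' => ?_⟩)
        obtain ⟨x, -, hx⟩ := Finset.mem_biUnion.1 hj'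
        obtain ⟨y, hy⟩ := (hC x j).1 hx
        exact hj x y hy
      omega
    · right
      refine ⟨x, (hU x).2 ⟨hzx, hfx⟩, x', (hU x').2 ⟨hzx', hfx'⟩, hxx', φ a,
        (hF _ _).2 ⟨a, haz, h.apply_mem a haX, Or.inl hxa⟩, φ b,
        (hF _ _).2 ⟨b, hbz, h.apply_mem b hbX, Or.inl hxb⟩, fun e => hab (hφ haX hbX e)⟩
  obtain ⟨g, hginj, hg'⟩ := key
  have hgz : ∀ r ∈ R, G.Adj z (g r) ∧ f (g r) = none := fun r hr => (hU _).1 (hg' r hr).1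
  let f' : V → Option (Fin N) := fun v => if hv : ∃ r ∈ R, g r = v then some hv.choose else f v
  have hnew : ∀ r ∈ R, f' (g r) = some r := by
    intro r hr
    have hv : ∃ r' ∈ R, g r' = g r := ⟨r, hr, rfl⟩
    simp only [f', hv, dite_true]
    rw [hginj hv.choose_spec.1 hr hv.choose_spec.2]
  have hext : ∀ v c, f v = some c → f' v = some c := by
    intro v c hv
    have : ¬ ∃ r ∈ R, g r = v := by
      rintro ⟨r, hr, rfl⟩
      rw [(hgz r hr).2] at hv
      exact absurd hv (by simp)
    simp only [f', this, dite_false, hv]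
  have hcases : ∀ v c, f' v = some c → f v = some c ∨ (c ∈ R ∧ g c = v) := by
    intro v c hv
    by_cases hex : ∃ r ∈ R, g r = v
    · obtain ⟨r, hr, rfl⟩ := hex
      rw [hnew r hr] at hv
      obtain rfl := Option.some.inj hv
      exact Or.inr ⟨hr, rfl⟩
    · simp only [f', hex, dite_false] at hv
      exact Or.inl hv
  have hnez : ∀ v c, c ∈ R → f v = some c → v ≠ z := by
    rintro v c hc hv rfl
    rw [h.apply_mem v hz] at hv
    exact ((hR c).1 hc).1 (Option.some.inj hv).symm
  have hmix : ∀ c ∈ R, ∀ v, f v = some c → ¬ G.Adj (g c) v := fun c hc v hv hadj =>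
    (hg' c hc).2 ((hF _ _).2 ⟨v, hnez v c hc hv, hv, Or.inl hadj⟩)
  refine ⟨f', ⟨?_, ?_, ?_, ?_, ?_, ?_⟩, hext⟩
  · exact Finset.insert_subset hz h.subset
  · exact fun w hw => hext w _ (h.apply_mem w hw)
  · intro u v huv c hu hv
    rcases hcases u c hu with hu | ⟨hc, rfl⟩ <;> rcases hcases v c hv with hv | ⟨hc', hv⟩
    · exact h.proper u v huv c hu hv
    · exact hmix c hc' u hu (hv ▸ huv.symm)
    · exact hmix c hc v hv huv
    · exact huv.ne hv
  · intro z' hz' hz'S x y hx hy c hfx hfy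
    obtain ⟨hne, hz'S⟩ := not_or.1 (fun e => hz'S (Finset.mem_insert.2 e))
    have hmix' : ∀ v w, c ∈ R → g c = v → f w = some c → G.Adj z' v → G.Adj z' w → False := by
      rintro v w hc rfl hw hv' hw'
      exact (hg' c hc).2 ((hF _ _).2
        ⟨w, hnez w c hc hw, hw, Or.inr ⟨z', hz', hz'S, hne, hv'.symm, hw'⟩⟩)
    rcases hcases x c hfx with hu | ⟨hc, hu⟩ <;> rcases hcases y c hfy with hv | ⟨hc', hv⟩
    · exact h.inj z' hz' hz'S x y hx hy c hu hv
    · exact (hmix' y x hc' hv hu hy hx).elim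
    · exact (hmix' x y hc hu hv hx hy).elim
    · exact hu.symm.trans hv
  · intro y c hy
    rcases hcases y c hy with hy | ⟨hc, rfl⟩
    · exact (h.near y c hy).imp_right fun ⟨s, hs, hys⟩ => ⟨s, Finset.mem_insert_of_mem hs, hys⟩
    · exact Or.inr ⟨z, Finset.mem_insert_self _ _, (hgz c hc).1.symm⟩
  · intro w hw c hc
    rcases Finset.mem_insert.1 hw with rfl | hw
    · by_cases hcB : c ∈ B
      · obtain ⟨x, hx, hfx⟩ := (hB c).1 hcB
        exact ⟨x, hx, hext x c hfx⟩
      · have hcR := (hR c).2 ⟨hc, hcB⟩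
        exact ⟨g c, (hgz c hcR).1, hnew c hcR⟩
    · obtain ⟨y, hy, hfy⟩ := h.sees w hw c hc
      exact ⟨y, hy, hext y c hfy⟩

end

section

variable {V : Type*} {G : SimpleGraph V} {N : ℕ} {X S : Finset V} {φ : V → Fin N}
  {f : V → Option (Fin N)}

theorem PartialBColoring.process [Fintype V] [DecidableEq V] [DecidableRel G.Adj]
    (hg : 9 ≤ G.egirth) (hφ : Set.InjOn φ X) (hX : X.card = N)
    (hdeg : ∀ z ∈ X, N ≤ G.degree z + 1) (h : PartialBColoring G X φ S f) (T : Finset V)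
    (hT : T ⊆ X)
    (hcond : ∀ S' f', PartialBColoring G X φ S' f' → S ⊆ S' → S' ⊆ S ∪ T →
      (∀ v c, f v = some c → f' v = some c) → ∀ z ∈ T, z ∉ S' → Processable G X S' f' z) :
    ∃ f', PartialBColoring G X φ (S ∪ T) f' ∧ ∀ v c, f v = some c → f' v = some c := by
  suffices H : ∀ T' ⊆ T, ∃ f', PartialBColoring G X φ (S ∪ T') f' ∧
      ∀ v c, f v = some c → f' v = some c from H T subset_rfl
  intro T'
  induction T' using Finset.induction_on with
  | empty => exact fun _ => ⟨f, by simpa using h, fun _ _ => id⟩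
  | insert z T' hz ih =>
    intro hsub
    obtain ⟨f₁, h₁, hf₁⟩ := ih ((Finset.subset_insert _ _).trans hsub)
    have hzT := hsub (Finset.mem_insert_self _ _)
    rw [Finset.union_insert]
    by_cases hzS : z ∈ S ∪ T'
    · exact ⟨f₁, by rwa [Finset.insert_eq_self.2 hzS], hf₁⟩
    · obtain ⟨f₂, h₂, hf₂⟩ := h₁.step hg hφ hX (hT hzT) hzS (hdeg z (hT hzT))
        (hcond _ f₁ h₁ Finset.subset_union_left
          (Finset.union_subset_union_right ((Finset.subset_insert _ _).trans hsub)) hf₁ z hzT hzS)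
      exact ⟨f₂, h₂, fun v c hv => hf₂ v c (hf₁ v c hv)⟩

/-- The partial coloring `g` is proper and extends `f`. -/
def ProperExt (G : SimpleGraph V) (f g : V → Option (Fin N)) : Prop :=
  (∀ u v, G.Adj u v → ∀ c, g u = some c → g v ≠ some c) ∧ ∀ v c, f v = some c → g v = some c

/-- The partial coloring `g` is a proper extension of `f` with as few uncolored vertices as
possible. -/
def IsMinExt [Fintype V] (G : SimpleGraph V) (f g : V → Option (Fin N)) : Prop :=
  ProperExt G f g ∧ ∀ g', ProperExt G f g' →
    (Finset.univ.filter fun v => g v = none).card ≤ (Finset.univ.filter fun v => g' v = none).card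

theorem PartialBColoring.properExt (h : PartialBColoring G X φ S f) : ProperExt G f f :=
  ⟨h.proper, fun _ _ => id⟩

theorem ProperExt.exists_isMinExt [Fintype V] {g₀ : V → Option (Fin N)} (h : ProperExt G f g₀) :
    ∃ g, IsMinExt G f g := by
  obtain ⟨g, hg, hmin⟩ := WellFounded.has_min
    (measure fun g : V → Option (Fin N) => (Finset.univ.filter fun v => g v = none).card).wf
    {g | ProperExt G f g} ⟨g₀, h⟩
  exact ⟨g, hg, fun g' hg' => not_lt.1 (hmin g' hg')⟩

theorem IsMinExt.exists_adj [Fintype V] {g : V → Option (Fin N)} (h : IsMinExt G f g) {v : V}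
    (hv : g v = none) (c : Fin N) : ∃ y, G.Adj v y ∧ g y = some c := by
  classical
  by_contra! hc
  have hext : ProperExt G f (Function.update g v (some c)) := by
    constructor
    · intro a b hab d ha hb
      by_cases hav : a = v
      · subst hav
        rw [Function.update_self] at ha
        rw [Function.update_of_ne hab.ne'] at hb
        exact hc b hab (hb.trans ha.symm)
      · rw [Function.update_of_ne hav] at ha
        by_cases hbv : b = v
        · subst hbv
          rw [Function.update_self] at hb
          exact hc a hab.symm (ha.trans hb.symm)
        · rw [Function.update_of_ne hbv] at hb
          exact h.1.1 a b hab d ha hb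
    · intro a d ha
      have := h.1.2 a d ha
      rwa [Function.update_of_ne (by rintro rfl; simp [hv] at this)]
  refine absurd (h.2 _ hext) (not_le.2 (Finset.card_lt_card ?_))
  refine Finset.ssubset_iff_of_subset (fun a ha => ?_) |>.2 ⟨v, by simp [hv], by simp⟩
  simp only [Finset.mem_filter, Finset.mem_univ, true_and] at ha ⊢
  by_cases hav : a = v
  · rw [hav, hv]
  · rwa [Function.update_of_ne hav] at ha

theorem IsMinExt.le_degree [Fintype V] [DecidableRel G.Adj] {g : V → Option (Fin N)}
    (h : IsMinExt G f g) {v : V} (hv : g v = none) : N ≤ G.degree v := by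
  choose y hy using h.exists_adj hv
  rw [← G.card_neighborFinset_eq_degree]
  calc N = (Finset.univ : Finset (Fin N)).card := by simp
    _ ≤ _ := Finset.card_le_card_of_injOn y (fun c _ => by simpa using (hy c).1) fun c _ d _ hcd => by
      have := (hy c).2
      rw [hcd, (hy d).2] at this
      exact (Option.some.inj this).symm

/-- At an uncolored vertex of degree `N`, every neighbor is colored, with distinct colors. -/
theorem IsMinExt.neighbors [Fintype V] [DecidableRel G.Adj] {g : V → Option (Fin N)}
    (h : IsMinExt G f g) {v : V} (hv : g v = none) (hdeg : G.degree v ≤ N) :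
    (∀ y, G.Adj v y → g y ≠ none) ∧
      ∀ y y', G.Adj v y → G.Adj v y' → g y = g y' → y = y' := by
  classical
  choose y hy using h.exists_adj hv
  have hinj : Function.Injective y := fun c d hcd => by
    have := (hy c).2
    rw [hcd, (hy d).2] at this
    exact (Option.some.inj this).symm
  have himg : Finset.univ.image y = G.neighborFinset v := by
    refine Finset.eq_of_subset_of_card_le (fun x hx => ?_) ?_
    · obtain ⟨c, -, rfl⟩ := Finset.mem_image.1 hx
      simpa using (hy c).1
    · rw [Finset.card_image_of_injective _ hinj]
      simpa using hdeg
  have hsurj : ∀ x, G.Adj v x → ∃ c, y c = x := fun x hx => by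
    have : x ∈ Finset.univ.image y := by rw [himg]; simpa using hx
    simpa using this
  constructor
  · rintro x hx
    obtain ⟨c, rfl⟩ := hsurj x hx
    simp [(hy c).2]
  · intro a b ha hb hab
    obtain ⟨c, rfl⟩ := hsurj a ha
    obtain ⟨d, rfl⟩ := hsurj b hb
    rw [(hy c).2, (hy d).2] at hab
    rw [Option.some.inj hab]

theorem PartialBColoring.isBColoring_of_total (h : PartialBColoring G X φ X f)
    (hφ : Set.InjOn φ X) (hX : X.card = N) {g : V → Option (Fin N)} (hg : ProperExt G f g)
    (htot : ∀ v, g v ≠ none) : ∃ C, IsBColoring G N C := by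
  classical
  choose C hC using fun v => Option.ne_none_iff_exists'.1 (htot v)
  refine ⟨C, fun u v huv huv' => hg.1 u v huv (C u) (hC u) (huv' ▸ hC v), fun i => ?_⟩
  have himg : X.image φ = Finset.univ := by
    rw [← Finset.card_eq_iff_eq_univ, Finset.card_image_of_injOn hφ, hX, Fintype.card_fin]
  obtain ⟨u, hu, rfl⟩ := Finset.mem_image.1 (himg ▸ Finset.mem_univ i)
  have hcol : C u = φ u :=
    Option.some.inj ((hC u).symm.trans (hg.2 u _ (h.apply_mem u hu)))
  refine ⟨u, hcol, fun j hj => ?_⟩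
  obtain ⟨y, hy, hfy⟩ := h.sees u hu j (hcol ▸ hj)
  exact ⟨y, hy, Option.some.inj ((hC y).symm.trans (hg.2 y _ hfy))⟩

theorem PartialBColoring.exists_isBColoring [Fintype V] [DecidableRel G.Adj]
    (h : PartialBColoring G X φ X f) (hφ : Set.InjOn φ X) (hX : X.card = N)
    (hdeg : ∀ v, v ∉ X → G.degree v < N) : ∃ C, IsBColoring G N C := by
  obtain ⟨g, hg⟩ := h.properExt.exists_isMinExt
  refine h.isBColoring_of_total hφ hX hg.1 fun v hv => ?_
  by_cases hvX : v ∈ X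
  · simp [hg.1.2 v _ (h.apply_mem v hvX)] at hv
  · exact absurd (hg.le_degree hv) (not_le.2 (hdeg v hvX))

theorem exists_injOn_of_card (X : Finset V) (hX : X.card = N) [Nonempty (Fin N)] :
    ∃ φ : V → Fin N, Set.InjOn φ X := by
  classical
  let e := X.equivFinOfCardEq hX
  refine ⟨fun v => if hv : v ∈ X then e ⟨v, hv⟩ else Classical.arbitrary _, fun u hu v hv huv => ?_⟩
  simp only [Finset.mem_coe] at hu hv
  simpa [hu, hv] using huv

/-- If all vertices of `X` have degree at least `N = |X|`, they can become b-vertices. -/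
theorem exists_partialBColoring_of_le_degree [Fintype V] [DecidableRel G.Adj]
    (hg : 9 ≤ G.egirth) (X : Finset V) (hX : X.card = N) (hφ : Set.InjOn φ X)
    (hdeg : ∀ z ∈ X, N ≤ G.degree z) :
    ∃ f, PartialBColoring G X φ X f := by
  classical
  obtain ⟨f, hf, -⟩ := (PartialBColoring.initial (G := G) X hφ).process hg hφ hX
    (fun z hz => (hdeg z hz).trans (Nat.le_succ _)) X subset_rfl
    fun _ _ _ _ _ _ z hz _ => Or.inl (hdeg z hz)
  exact ⟨f, by simpa using hf⟩

theorem IsBColoring.card_le [Fintype V] {k : ℕ} {C : V → Fin k} (h : IsBColoring G k C) :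
    k ≤ Fintype.card V := by
  simpa using Fintype.card_le_of_surjective C fun i => (h.2 i).imp fun _ => And.left

theorem IsBColoring.le_bChromatic [Fintype V] {k : ℕ} {C : V → Fin k} (h : IsBColoring G k C) :
    k ≤ bChromatic G :=
  le_csSup ⟨Fintype.card V, fun _ ⟨_, hC⟩ => hC.card_le⟩ ⟨C, h⟩

/-- A coloring with the fewest colors is a b-coloring. -/
theorem exists_le_bChromatic_colorable [Fintype V] (G : SimpleGraph V) :
    ∃ n ≤ bChromatic G, G.Colorable n := by
  classical
  have hex : ∃ n, G.Colorable n := ⟨_, G.colorable_of_fintype⟩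
  refine ⟨Nat.find hex, ?_, Nat.find_spec hex⟩
  obtain ⟨C⟩ := Nat.find_spec hex
  refine IsBColoring.le_bChromatic (C := C) ⟨fun u v huv => C.valid huv, fun i => ?_⟩
  by_contra! hi
  have hrec : ∀ u, ∃ j, j ≠ i ∧ (C u ≠ i → j = C u) ∧
      (C u = i → ∀ w, G.Adj u w → C w ≠ j) := by
    intro u
    by_cases hu : C u = i
    · have := hi u hu
      unfold IsBVertex at this
      push Not at this
      obtain ⟨j, hj, hj'⟩ := this
      exact ⟨j, hu ▸ hj, fun h => absurd hu h, fun _ => hj'⟩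
    · exact ⟨C u, hu, fun _ => rfl, fun h => absurd h hu⟩
  choose C' hC' hC1 hC2 using hrec
  have hcol : G.Colorable (Fintype.card {j // j ≠ i}) := by
    refine (SimpleGraph.Coloring.mk (fun u => (⟨C' u, hC' u⟩ : {j // j ≠ i})) ?_).colorable
    intro u v huv heq
    have heq' : C' u = C' v := congrArg Subtype.val heq
    have hne := C.valid huv
    by_cases hu : C u = i
    · have hv : C v ≠ i := fun hv => hne (hu.trans hv.symm)
      exact hC2 u hu v huv ((hC1 v hv).symm.trans heq'.symm)
    · by_cases hv : C v = i
      · exact hC2 v hv u huv.symm ((hC1 u hu).symm.trans heq')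
      · exact hne ((hC1 u hu).symm.trans (heq'.trans (hC1 v hv)))
  have hlt : Fintype.card {j // j ≠ i} < Nat.find hex := by
    simpa using Fintype.card_subtype_lt (p := fun j => j ≠ i) (x := i) (by simp)
  exact Nat.find_min hex hlt hcol

theorem bddAbove_mParam [Fintype V] (G : SimpleGraph V) [DecidableRel G.Adj] :
    BddAbove {k : ℕ | k ≤ (Finset.univ.filter fun v => k - 1 ≤ G.degree v).card} :=
  ⟨Fintype.card V, fun _ hk => hk.trans (Finset.card_le_univ _)⟩

theorem mParam_le_card [Fintype V] (G : SimpleGraph V) [DecidableRel G.Adj] :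
    mParam G ≤ (Finset.univ.filter fun v => mParam G - 1 ≤ G.degree v).card :=
  Nat.sSup_mem ⟨0, by simp⟩ (bddAbove_mParam G)

theorem card_mParam_le_degree [Fintype V] (G : SimpleGraph V) [DecidableRel G.Adj] :
    (Finset.univ.filter fun v => mParam G ≤ G.degree v).card ≤ mParam G := by
  by_contra! h
  have : mParam G + 1 ≤ mParam G := le_csSup (bddAbove_mParam G) (by simpa using h)
  omega

end

/-- There is a walk of length at most three from `a` to `b`. -/
def Near {V : Type*} (G : SimpleGraph V) (a b : V) : Prop :=
  a = b ∨ G.Adj a b ∨ (∃ x, G.Adj a x ∧ G.Adj x b) ∨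
    ∃ x y, G.Adj a x ∧ G.Adj x y ∧ G.Adj y b

theorem exists_isBColoring_of_not_near {V : Type*} {G : SimpleGraph V} {N : ℕ} {X : Finset V}
    [Fintype V] [DecidableRel G.Adj] (hg : 9 ≤ G.egirth) (hX : X.card = N)
    (hdeg : ∀ z ∈ X, N ≤ G.degree z + 1) (hout : ∀ v, v ∉ X → G.degree v < N)
    {a b : V} (ha : a ∈ X) (hb : b ∈ X) (hab : ¬ Near G a b)
    (hpath : ∀ z x u, z ∈ X → x ∉ X → u ∈ X → G.Adj a z → G.Adj z x → G.Adj x u → ¬ G.Adj u b) :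
    ∃ C, IsBColoring G N C := by
  classical
  have : Nonempty (Fin N) := ⟨⟨0, hX ▸ Finset.card_pos.2 ⟨a, ha⟩⟩⟩
  obtain ⟨φ, hφ⟩ := exists_injOn_of_card X hX
  simp only [Near, not_or, not_exists, not_and] at hab
  obtain ⟨hne, h1, h2, h3⟩ := hab
  have hsymm : ∀ {u v}, G.Adj u v → G.Adj v u := fun h => h.symm
  obtain ⟨f₁, hf₁, -⟩ := (PartialBColoring.initial (G := G) X hφ).process hg hφ hX hdeg
    (X.filter fun z => G.Adj a z ∨ G.Adj z b) (Finset.filter_subset _ _) (by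
      intro S f hf _ hS _ z hz hzS
      simp only [Finset.empty_union] at hS
      have haS : a ∉ S := fun h => by
        rcases (Finset.mem_filter.1 (hS h)).2 with h | h
        · exact h.ne rfl
        · exact h1 h
      have hbS : b ∉ S := fun h => by
        rcases (Finset.mem_filter.1 (hS h)).2 with h | h
        · exact h1 h
        · exact h.ne rfl
      have hxX := @PartialBColoring.not_mem_of_eq_none _ _ _ _ _ _ _ hf
      obtain ⟨hzX, hz | hz⟩ := Finset.mem_filter.1 hz
      · refine Or.inr (Or.inr (Or.inl ⟨b, hb, fun e => h1 (e ▸ hz), ?_⟩))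
        rintro x y ⟨hzx, hyz, hy, ⟨hyX, rfl⟩ | ⟨-, hbS', -⟩, hxy⟩
        · rcases hxy with rfl | ⟨hfx, hxy | ⟨u, huX, huS, huz, hxu, huy⟩⟩
          · exact h2 z hz hzx
          · exact h3 z x hz hzx hxy
          · exact hpath z x u hzX (hxX hfx) huX hz hzx hxu huy
        · exact hbS hbS'
      · refine Or.inr (Or.inr (Or.inl ⟨a, ha, fun e => h1 (e ▸ hz), ?_⟩))
        rintro x y ⟨hzx, hyz, hy, ⟨hyX, rfl⟩ | ⟨-, haS', -⟩, hxy⟩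
        · rcases hxy with rfl | ⟨hfx, hxy | ⟨u, huX, huS, huz, hxu, huy⟩⟩
          · exact h2 z hzx.symm hz
          · exact h3 x z hxy.symm hzx.symm hz
          · exact hpath u x z huX (hxX hfx) hzX huy.symm hxu.symm hzx.symm hz
        · exact haS haS')
  obtain ⟨f₂, hf₂, -⟩ := hf₁.process hg hφ hX hdeg (X.filter fun z => z ≠ a ∧ z ≠ b)
    (Finset.filter_subset _ _) (by
      intro S f hf hS' hS _ z hz hzS
      obtain ⟨hzX, hza, hzb⟩ := Finset.mem_filter.1 hz
      have hN : ∀ u ∈ X, u ∉ S → ¬ G.Adj a u ∧ ¬ G.Adj u b := fun u hu huS => by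
        refine not_or.1 fun h => huS (hS' ?_)
        simp [hu, h]
      have haS : a ∉ S := fun h => by
        have := hS h
        simp [h1] at this
      have hbS : b ∉ S := fun h => by
        have := hS h
        simp [h1] at this
      by_cases hca : ∀ x y, ¬ Charge G X S f z x y a
      · exact Or.inr (Or.inr (Or.inl ⟨a, ha, hza.symm, hca⟩))
      by_cases hcb : ∀ x y, ¬ Charge G X S f z x y b
      · exact Or.inr (Or.inr (Or.inl ⟨b, hb, hzb.symm, hcb⟩))
      have hax : ∃ x, G.Adj z x ∧ f x = none ∧ G.Adj x a := by
        push Not at hca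
        obtain ⟨x, y, hzx, hyz, hy, ⟨hyX, rfl⟩ | ⟨-, haS', -⟩, hxy⟩ := hca
        · rcases hxy with rfl | ⟨hfx, hxy | ⟨u, huX, huS, huz, hxu, huy⟩⟩
          · exact absurd hzx.symm (hN z hzX hzS).1
          · exact ⟨x, hzx, hfx, hxy⟩
          · exact absurd huy.symm (hN u huX huS).1
        · exact absurd haS' haS
      have hbx : ∃ x, G.Adj z x ∧ f x = none ∧ G.Adj x b := by
        push Not at hcb
        obtain ⟨x, y, hzx, hyz, hy, ⟨hyX, rfl⟩ | ⟨-, hbS', -⟩, hxy⟩ := hcb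
        · rcases hxy with rfl | ⟨hfx, hxy | ⟨u, huX, huS, huz, hxu, huy⟩⟩
          · exact absurd hzx (hN z hzX hzS).2
          · exact ⟨x, hzx, hfx, hxy⟩
          · exact absurd huy (hN u huX huS).2
        · exact absurd hbS' hbS
      obtain ⟨x, hzx, hfx, hxa⟩ := hax
      obtain ⟨x', hzx', hfx', hxb⟩ := hbx
      refine Or.inr (Or.inr (Or.inr ⟨x, x', a, b, ?_, hne, hzx, hzx', hfx, hfx', ha, hb,
        hza.symm, hzb.symm, hxa, hxb⟩))
      rintro rfl
      exact h2 x hxa.symm hxb)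
  have hS₂ : (∅ ∪ X.filter fun z => G.Adj a z ∨ G.Adj z b) ∪ (X.filter fun z => z ≠ a ∧ z ≠ b) =
      (X.erase a).erase b := by
    ext z
    simp only [Finset.mem_union, Finset.mem_filter, Finset.mem_erase, Finset.notMem_empty, false_or]
    constructor
    · rintro (⟨hz, h | h⟩ | ⟨hz, h, h'⟩)
      · exact ⟨by rintro rfl; exact h1 h, h.ne', hz⟩
      · exact ⟨h.ne, by rintro rfl; exact h1 h, hz⟩
      · exact ⟨h', h, hz⟩
    · rintro ⟨h', h, hz⟩
      exact Or.inr ⟨hz, h, h'⟩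
  rw [hS₂] at hf₂
  obtain ⟨f₃, hf₃, -⟩ := hf₂.step hg hφ hX ha (by simp) (hdeg a ha) (by
    refine Or.inr (Or.inr (Or.inl ⟨b, hb, Ne.symm hne, ?_⟩))
    rintro x y ⟨hzx, hyz, hy, ⟨hyX, rfl⟩ | ⟨-, hbS, -⟩, hxy⟩
    · rcases hxy with rfl | ⟨hfx, hxy | ⟨u, huX, huS, huz, hxu, huy⟩⟩
      · exact h1 hzx
      · exact h2 x hzx hxy
      · exact h3 x u hzx hxu huy
    · simp at hbS)
  have hS₃ : insert a ((X.erase a).erase b) = X.erase b := by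
    rw [Finset.erase_right_comm, Finset.insert_erase (Finset.mem_erase.2 ⟨hne, ha⟩)]
  rw [hS₃] at hf₃
  obtain ⟨f₄, hf₄, -⟩ := hf₃.step hg hφ hX hb (by simp) (hdeg b hb) (by
    refine Or.inr (Or.inr (Or.inl ⟨a, ha, hne, ?_⟩))
    have hu0 : ∀ u ∈ X, u ∉ X.erase b → u ≠ b → False := fun u hu hu' hub =>
      hu' (Finset.mem_erase.2 ⟨hub, hu⟩)
    rintro x y ⟨hzx, hyz, hy, ⟨hyX, rfl⟩ | ⟨-, -, hya⟩, hxy⟩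
    · rcases hxy with rfl | ⟨hfx, hxy | ⟨u, huX, huS, huz, hxu, huy⟩⟩
      · exact h1 hzx.symm
      · exact h2 x hxy.symm hzx.symm
      · exact hu0 u huX huS huz
    · rcases hxy with rfl | ⟨hfx, hxy | ⟨u, huX, huS, huz, hxu, huy⟩⟩
      · exact h2 y hya.symm hzx.symm
      · exact h3 y x hya.symm hxy.symm hzx.symm
      · exact hu0 u huX huS huz)
  rw [Finset.insert_erase hb] at hf₄
  exact hf₄.exists_isBColoring hφ hX hout

section

variable {V : Type*} {G : SimpleGraph V}

theorem Near.exists_walk {a b : V} (h : Near G a b) : ∃ p : G.Walk a b, p.length ≤ 3 := by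
  rcases h with rfl | h | ⟨x, h₁, h₂⟩ | ⟨x, y, h₁, h₂, h₃⟩
  · exact ⟨.nil, by simp⟩
  · exact ⟨.cons h .nil, by simp⟩
  · exact ⟨.cons h₁ (.cons h₂ .nil), by simp⟩
  · exact ⟨.cons h₁ (.cons h₂ (.cons h₃ .nil)), by simp⟩

theorem Near.reachable {a b : V} (h : Near G a b) : G.Reachable a b :=
  h.exists_walk.elim fun p _ => p.reachable

theorem Near.dist_le {a b : V} (h : Near G a b) : G.dist a b ≤ 3 :=
  h.exists_walk.elim fun p hp => (SimpleGraph.dist_le p).trans hp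

theorem Near.length_eq_of_isChain (hg : 9 ≤ G.egirth) {a b : V} (h : Near G a b) {l : List V}
    (h₁ : List.IsChain G.Adj (a :: l)) (h₂ : (a :: l).Nodup)
    (h₃ : (a :: l).getLast (by simp) = b) (h₄ : l.length ≤ 5) : l.length ≤ 3 := by
  classical
  obtain ⟨p, hp⟩ := h.exists_walk
  have hp' := p.length_bypass_le_length
  subst h₃
  let q : G.Walk a ((a :: l).getLast (by simp)) :=
    (SimpleGraph.Walk.ofSupport (a :: l) (by simp) h₁).copy (by simp) rfl
  have hqs : q.support = a :: l :=
    (SimpleGraph.Walk.support_copy _ _ _).trans (SimpleGraph.Walk.support_ofSupport _ _)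
  have hql : q.length = l.length := by
    have := q.length_support
    rw [hqs, List.length_cons] at this
    omega
  have hq : q.IsPath := by
    rwa [SimpleGraph.Walk.isPath_def, hqs]
  rw [← hql, ← eq_of_isPath_of_length_add_le hg p.bypass_isPath hq (by omega)]
  omega

theorem not_adj_of_adj_adj (hg : 9 ≤ G.egirth) {a b c : V} (hab : G.Adj a b) (hbc : G.Adj b c) :
    ¬ G.Adj a c := fun hac => by
  have := path_list_unique hg (z := a) (l₁ := [c]) (l₂ := [b, c]) (by simp [hac])
    (by simp [hab, hbc]) (by simp [hac.ne]) (by simp [hac.ne, hab.ne, hbc.ne]) (by simp) (by simp)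
  simp at this

theorem eq_of_common_adj (hg : 9 ≤ G.egirth) {a b x y : V} (hab : a ≠ b) (hax : G.Adj a x)
    (hxb : G.Adj x b) (hay : G.Adj a y) (hyb : G.Adj y b) : x = y := by
  have := path_list_unique hg (z := a) (l₁ := [x, b]) (l₂ := [y, b]) (by simp [hax, hxb])
    (by simp [hay, hyb]) (by simp [hab, hax.ne, hxb.ne]) (by simp [hab, hay.ne, hyb.ne])
    (by simp) (by simp)
  simpa using this

theorem exists_isPath_cons {h x w : V} (hx : G.Adj h x) (hw : G.Reachable h w)
    (hle : G.dist x w ≤ G.dist h w) :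
    ∃ p : G.Walk x w, (SimpleGraph.Walk.cons hx p).IsPath ∧ p.length = G.dist x w := by
  classical
  obtain ⟨p, hp, hlen⟩ := (hx.symm.reachable.trans hw).exists_path_of_dist
  refine ⟨p, hp.cons fun hmem => ?_, hlen⟩
  have h₁ := congrArg SimpleGraph.Walk.length (p.take_spec hmem)
  rw [SimpleGraph.Walk.length_append] at h₁
  have h₂ := SimpleGraph.dist_le (p.dropUntil h hmem)
  have h₃ : (p.takeUntil h hmem).length ≠ 0 := fun h0 =>
    hx.ne (SimpleGraph.Walk.eq_of_length_eq_zero h0).symm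
  omega

theorem eq_of_adj_of_dist_lt (hg : 9 ≤ G.egirth) {h x y w : V} (hw : G.Reachable h w)
    (hd : G.dist h w ≤ 3) (hx : G.Adj h x) (hy : G.Adj h y) (hxw : G.dist x w < G.dist h w)
    (hyw : G.dist y w < G.dist h w) : x = y := by
  obtain ⟨p, hp, hpl⟩ := exists_isPath_cons hx hw hxw.le
  obtain ⟨q, hq, hql⟩ := exists_isPath_cons hy hw hyw.le
  have := eq_of_isPath_of_length_add_le hg hp hq (by simp; omega)
  simp only [SimpleGraph.Walk.cons.injEq] at this
  exact this.1

theorem dist_ne_of_adj (hg : 9 ≤ G.egirth) {h x w : V} (hw : G.Reachable h w)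
    (hd : G.dist h w ≤ 3) (hx : G.Adj h x) : G.dist x w ≠ G.dist h w := by
  intro he
  obtain ⟨p, hp, hpl⟩ := exists_isPath_cons hx hw he.le
  obtain ⟨q, hq, hql⟩ := hw.exists_path_of_dist
  have := congrArg SimpleGraph.Walk.length
    (eq_of_isPath_of_length_add_le hg hp hq (by simp; omega))
  simp at this
  omega

/-- A path whose first step increases `d` keeps increasing `d`, if every vertex has at most one
neighbor with a smaller value of `d`. -/
theorem exists_adj_lt_of_walk {K : SimpleGraph V} {d : V → ℕ} {a b : V} (p : K.Walk a b)
    (hne : ∀ x y, x ∈ p.support → K.Adj x y → d y ≠ d x)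
    (huniq : ∀ h x y, h ∈ p.support → K.Adj h x → K.Adj h y → d x < d h → d y < d h → x = y)
    (hp : p.IsPath) : ∀ u, K.Adj a u → u ∉ p.support → d u < d a →
      ∃ x, K.Adj b x ∧ d x < d b := by
  induction p with
  | nil => exact fun u hu _ hlt => ⟨u, hu, hlt⟩
  | @cons a c b hac p ih =>
    intro u hu hup hlt
    rw [SimpleGraph.Walk.cons_isPath_iff] at hp
    refine ih (fun x y hx => hne x y (by simp [hx])) (fun h x y hh => huniq h x y (by simp [hh]))
      hp.1 a hac.symm hp.2 ?_
    have h₁ := hne a c (by simp) hac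
    by_contra hlt'
    have := huniq a u c (by simp) hu hac hlt (by omega)
    subst this
    simp at hup

variable {N : ℕ} {W : Finset V} {φ : V → Fin N} {f : V → Option (Fin N)}

/-- An assignment of vertices of `W` to the colored neighbors of a vertex. -/
theorem PartialBColoring.exists_anchor (hg : 9 ≤ G.egirth) (h : PartialBColoring G W φ W f)
    {v : V} (hv : v ∉ W) : ∃ e : V → V, (∀ y, f y ≠ none → e y ∈ W ∧
      ((y ∈ W ∧ e y = y) ∨ (y ∉ W ∧ G.Adj y (e y)))) ∧
      ∀ y y', G.Adj v y → G.Adj v y' → f y ≠ none → f y' ≠ none → e y = e y' → y = y' := by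
  have hex : ∀ y, ∃ w, f y ≠ none → w ∈ W ∧ ((y ∈ W ∧ w = y) ∨ (y ∉ W ∧ G.Adj y w)) := by
    intro y
    by_cases hy : f y = none
    · exact ⟨y, fun h => absurd hy h⟩
    · obtain ⟨c, hc⟩ := Option.ne_none_iff_exists'.1 hy
      by_cases hyW : y ∈ W
      · exact ⟨y, fun _ => ⟨hyW, Or.inl ⟨hyW, rfl⟩⟩⟩
      · obtain hy' | ⟨s, hs, hys⟩ := h.near y c hc
        · exact absurd hy' hyW
        · exact ⟨s, fun _ => ⟨hs, Or.inr ⟨hyW, hys⟩⟩⟩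
  choose e he using hex
  refine ⟨e, he, fun y y' hy hy' hfy hfy' hee => ?_⟩
  obtain ⟨h₁, ⟨h₂, h₃⟩ | ⟨h₂, h₃⟩⟩ := he y hfy <;>
    obtain ⟨h₁', ⟨h₂', h₃'⟩ | ⟨h₂', h₃'⟩⟩ := he y' hfy'
  · rw [← h₃, ← h₃', hee]
  · rw [← hee, h₃] at h₃'
    exact absurd hy (not_adj_of_adj_adj hg hy' h₃')
  · rw [hee, h₃'] at h₃
    exact absurd hy' (not_adj_of_adj_adj hg hy h₃)
  · refine eq_of_common_adj hg ?_ hy h₃ hy' (hee ▸ h₃')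
    rintro rfl
    exact hv h₁

theorem false_of_component [Fintype V] [DecidableRel G.Adj] (hg : 9 ≤ G.egirth)
    (hN : 3 ≤ N) (hW : W.card = N) (h₀ : PartialBColoring G W φ W f) {K : SimpleGraph V}
    (hK : ∀ a b, K.Adj a b ↔ G.Adj a b ∧ f a = none ∧ f b = none) {v : V}
    (hv : ∀ h, K.Reachable v h → (∃ h', K.Adj h h') ∧ G.degree h = N ∧ ∀ w ∈ W, Near G h w) :
    False := by
  classical
  have hone : ∀ h, K.Reachable v h → f h = none := fun h hh => by
    obtain ⟨⟨h', hh'⟩, -⟩ := hv h hh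
    exact ((hK h h').1 hh').2.1
  have hnW : ∀ h, f h = none → h ∉ W := fun h hh => h₀.not_mem_of_eq_none hh
  -- Next to a colored neighbor of `h` anchored at `w`, no uncolored neighbor is closer to `w`.
  have hhang : ∀ h, K.Reachable v h → ∀ w ∈ W, ∀ y, G.Adj h y → f y ≠ none →
      (y = w ∨ G.Adj y w) → ∀ h', K.Adj h h' → ¬ G.dist h' w < G.dist h w := by
    intro h hh w hw y hy hfy hyw h' hh' hlt
    obtain ⟨hadj, -, hf'⟩ := (hK h h').1 hh'
    have hnear := (hv h hh).2.2 w hw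
    have hyw1 : G.dist y w ≤ 1 := by
      rcases hyw with rfl | hyw
      · simp
      · exact (SimpleGraph.dist_eq_one_iff_adj.2 hyw).le
    have h0 : G.dist h' w ≠ 0 := by
      rw [Ne, (hadj.symm.reachable.trans hnear.reachable).dist_eq_zero_iff]
      rintro rfl
      exact hnW _ hf' hw
    have := eq_of_adj_of_dist_lt hg hnear.reachable hnear.dist_le hy hadj (by omega) hlt
    exact hfy (this ▸ hf')
  have hmax : ∀ w ∈ W, ∃ l, K.Reachable v l ∧ (∃ l', K.Adj l l' ∧ G.dist l' w < G.dist l w) ∧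
      ∀ w' ∈ W, w' ≠ w → ∃ y, G.Adj l y ∧ f y ≠ none ∧ (y = w' ∨ G.Adj y w') := by
    intro w hw
    obtain ⟨l, hl, hlmax⟩ := Finset.exists_max_image (Finset.univ.filter fun h => K.Reachable v h)
      (fun h => G.dist h w) ⟨v, by simp⟩
    simp only [Finset.mem_filter, Finset.mem_univ, true_and] at hl hlmax
    obtain ⟨⟨l', hl'⟩, hdeg, hnear⟩ := hv l hl
    have hlow : ∀ x, K.Adj l x → G.dist x w < G.dist l w := fun x hx =>
      lt_of_le_of_ne (hlmax x (hl.trans hx.reachable))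
        (dist_ne_of_adj hg (hnear w hw).reachable (hnear w hw).dist_le ((hK _ _).1 hx).1)
    have hcol : ∀ x ∈ (G.neighborFinset l).erase l', G.Adj l x ∧ f x ≠ none := by
      intro x hx
      rw [Finset.mem_erase, SimpleGraph.mem_neighborFinset] at hx
      refine ⟨hx.2, fun hfx => hx.1 ?_⟩
      have hlx : K.Adj l x := (hK _ _).2 ⟨hx.2, hone l hl, hfx⟩
      exact eq_of_adj_of_dist_lt hg (hnear w hw).reachable (hnear w hw).dist_le hx.2
        ((hK _ _).1 hl').1 (hlow x hlx) (hlow l' hl')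
    obtain ⟨e, he, heinj⟩ := h₀.exists_anchor hg (hnW l (hone l hl))
    have he' : ∀ y, f y ≠ none → y = e y ∨ G.Adj y (e y) := fun y hy =>
      (he y hy).2.imp (fun h => h.2.symm) And.right
    have himg : ((G.neighborFinset l).erase l').image e = W.erase w := by
      refine Finset.eq_of_subset_of_card_le (fun x hx => ?_) ?_
      · obtain ⟨y, hy, rfl⟩ := Finset.mem_image.1 hx
        obtain ⟨hy₁, hy₂⟩ := hcol y hy
        refine Finset.mem_erase.2 ⟨fun hew => ?_, (he y hy₂).1⟩
        exact hhang l hl w hw y hy₁ hy₂ (hew ▸ he' y hy₂) l' hl' (hlow l' hl')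
      · rw [Finset.card_image_of_injOn, Finset.card_erase_of_mem hw, Finset.card_erase_of_mem,
          SimpleGraph.card_neighborFinset_eq_degree, hdeg, hW]
        · simpa using ((hK _ _).1 hl').1
        · intro y hy y' hy' hee
          exact heinj y y' (hcol y hy).1 (hcol y' hy').1 (hcol y hy).2 (hcol y' hy').2 hee
    refine ⟨l, hl, ⟨l', hl', hlow l' hl'⟩, fun w' hw' hne => ?_⟩
    have : w' ∈ ((G.neighborFinset l).erase l').image e := by
      rw [himg]
      exact Finset.mem_erase.2 ⟨hne, hw'⟩
    obtain ⟨y, hy, rfl⟩ := Finset.mem_image.1 this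
    exact ⟨y, (hcol y hy).1, (hcol y hy).2, he' y (hcol y hy).2⟩
  obtain ⟨w₁, w₂, w₃, hw₁, hw₂, hw₃, h₁₂, h₁₃, h₂₃⟩ := Finset.two_lt_card_iff.1 (by omega : 2 < W.card)
  obtain ⟨l₁, hl₁, ⟨l₁', hl₁', hlt₁⟩, hh₁⟩ := hmax w₁ hw₁
  obtain ⟨l₂, hl₂, -, hh₂⟩ := hmax w₂ hw₂
  have hloc : ∀ l, K.Reachable v l → ∀ w ∈ W, (∃ y, G.Adj l y ∧ f y ≠ none ∧ (y = w ∨ G.Adj y w)) →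
      ∀ x, K.Adj l x → ¬ G.dist x w < G.dist l w := by
    rintro l hl w hw ⟨y, hy₁, hy₂, hy₃⟩
    exact hhang l hl w hw y hy₁ hy₂ hy₃
  have hne : l₁ ≠ l₂ := by
    rintro rfl
    exact hloc l₁ hl₁ w₁ hw₁ (hh₂ w₁ hw₁ h₁₂) l₁' hl₁' hlt₁
  obtain ⟨p, hp⟩ := (hl₁.symm.trans hl₂).exists_isPath
  have hreach : ∀ x ∈ p.support, K.Reachable v x := fun x hx =>
    hl₁.trans (p.takeUntil x hx).reachable
  cases p with
  | nil => exact hne rfl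
  | @cons _ c _ hc p =>
    rw [SimpleGraph.Walk.cons_isPath_iff] at hp
    have hdist : ∀ x y, K.Reachable v x → K.Adj x y → G.dist y w₃ ≠ G.dist x w₃ :=
      fun x y hx hxy => dist_ne_of_adj hg ((hv x hx).2.2 w₃ hw₃).reachable
        ((hv x hx).2.2 w₃ hw₃).dist_le ((hK _ _).1 hxy).1
    obtain ⟨x, hx, hlt⟩ := exists_adj_lt_of_walk (d := fun x => G.dist x w₃) p
      (fun x y hx hxy => hdist x y (hreach x (by simp [hx])) hxy)
      (fun h x y hh hx hy hxw hyw => by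
        have := (hv h (hreach h (by simp [hh]))).2.2 w₃ hw₃
        exact eq_of_adj_of_dist_lt hg this.reachable this.dist_le ((hK _ _).1 hx).1
          ((hK _ _).1 hy).1 hxw hyw) hp.1 l₁ hc.symm hp.2 (by
        have h₁ := hloc l₁ hl₁ w₃ hw₃ (hh₁ w₃ hw₃ h₁₃.symm) c hc
        have h₂ := hdist l₁ c hl₁ hc
        omega)
    exact hloc l₂ hl₂ w₃ hw₃ (hh₂ w₃ hw₃ h₂₃.symm) x hx hlt

end

section

variable {V : Type*} {G : SimpleGraph V}

theorem exists_isBColoring_of_isolated [Fintype V] [DecidableRel G.Adj] (hg : 9 ≤ G.egirth) {k : ℕ}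
    (hk : 2 ≤ k) {W : Finset V} (hW : W.card = k) {φ : V → Fin k} (hφ : Set.InjOn φ W)
    {f : V → Option (Fin k)} (h₀ : PartialBColoring G W φ W f) (hWdeg : ∀ z ∈ W, k ≤ G.degree z)
    (hout : ∀ v, v ∉ W → G.degree v ≤ k) {v : V} (hv : f v = none) (hdeg : G.degree v = k)
    (hcol : ∀ y, G.Adj v y → f y ≠ none) (hall : ∀ c, ∃ y, G.Adj v y ∧ f y = some c) :
    ∃ C, IsBColoring G (k + 1) C := by
  classical
  have hvW : v ∉ W := h₀.not_mem_of_eq_none hv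
  have hX : (insert v W).card = k + 1 := by rw [Finset.card_insert_of_notMem hvW, hW]
  have hXdeg : ∀ z ∈ insert v W, k + 1 ≤ G.degree z + 1 := by
    intro z hz
    rcases Finset.mem_insert.1 hz with rfl | hz
    · omega
    · have := hWdeg z hz
      omega
  have hXout : ∀ u, u ∉ insert v W → G.degree u < k + 1 := fun u hu =>
    Nat.lt_succ_of_le (hout u fun hu' => hu (Finset.mem_insert_of_mem hu'))
  obtain ⟨ψ, hψ⟩ := exists_injOn_of_card _ hX
  obtain ⟨e, he, heinj⟩ := h₀.exists_anchor hg hvW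
  have hesurj : ∀ w ∈ W, ∃ y, G.Adj v y ∧ e y = w := by
    have himg : (G.neighborFinset v).image e = W := by
      refine Finset.eq_of_subset_of_card_le (fun x hx => ?_) ?_
      · obtain ⟨y, hy, rfl⟩ := Finset.mem_image.1 hx
        exact (he y (hcol y (by simpa using hy))).1
      · rw [Finset.card_image_of_injOn, SimpleGraph.card_neighborFinset_eq_degree, hdeg, hW]
        intro y hy y' hy' hee
        have hy : G.Adj v y := by simpa using hy
        have hy' : G.Adj v y' := by simpa using hy'
        exact heinj y y' hy hy' (hcol y hy) (hcol y' hy') hee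
    intro w hw
    obtain ⟨y, hy, hyw⟩ := Finset.mem_image.1 (himg.symm ▸ hw)
    exact ⟨y, by simpa using hy, hyw⟩
  have hinit := PartialBColoring.initial (G := G) (insert v W) hψ
  obtain ⟨f₁, hf₁, -⟩ := hinit.step hg hψ hX (Finset.mem_insert_self _ _) (by simp)
    (hXdeg v (Finset.mem_insert_self _ _)) (by
      by_cases hP : ∀ x, G.Adj v x → x ∈ W
      · exact Or.inr (Or.inl fun x hx => by simp [hP x hx])
      · push Not at hP
        obtain ⟨x, hvx, hxW⟩ := hP
        obtain ⟨hexW, ⟨h, -⟩ | ⟨-, hxe⟩⟩ := he x (hcol x hvx)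
        · exact absurd h hxW
        obtain ⟨y, hvy, hfy⟩ := hall (φ (e x))
        have hfe := h₀.apply_mem _ hexW
        have hyW : y ∉ W := fun hyW => by
          rw [h₀.apply_mem y hyW] at hfy
          have := hφ hyW hexW (Option.some.inj hfy)
          exact not_adj_of_adj_adj hg hvx hxe (this ▸ hvy)
        have hxy : x ≠ y := by
          rintro rfl
          exact h₀.proper x _ hxe _ hfy hfe
        obtain ⟨heyW, ⟨h, -⟩ | ⟨-, hye⟩⟩ := he y (hcol y hvy)
        · exact absurd h hyW
        refine Or.inr (Or.inr (Or.inr ⟨x, y, e x, e y, hxy, fun hee => hxy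
          (heinj x y hvx hvy (hcol x hvx) (hcol y hvy) hee), hvx, hvy, ?_, ?_,
          Finset.mem_insert_of_mem hexW, Finset.mem_insert_of_mem heyW, ?_, ?_, hxe, hye⟩))
        · simp [hxW, hvx.ne']
        · simp [hyW, hvy.ne']
        · rintro h
          exact hvW (h ▸ hexW)
        · rintro h
          exact hvW (h ▸ heyW))
  have hf₁col : ∀ y, G.Adj v y → f₁ y ≠ none := by
    have hsub : (Finset.univ.erase (ψ v)).card ≤
        ((G.neighborFinset v).filter fun y => f₁ y ≠ none).card := by
      refine Finset.card_le_card_of_forall_subsingleton (fun c y => f₁ y = some c) ?_ ?_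
      · intro c hc
        obtain ⟨y, hy, hfy⟩ := hf₁.sees v (by simp) c (Finset.ne_of_mem_erase hc)
        exact ⟨y, by simp [hy, hfy], hfy⟩
      · rintro y - c ⟨-, hc⟩ d ⟨-, hd⟩
        exact Option.some.inj (hc.symm.trans hd)
    have heq := Finset.eq_of_subset_of_card_le
      (Finset.filter_subset (fun y => f₁ y ≠ none) (G.neighborFinset v)) (by
        simpa [hdeg] using hsub)
    intro y hy
    have : y ∈ (G.neighborFinset v).filter fun y => f₁ y ≠ none := by
      rw [heq]
      simpa using hy
    exact (Finset.mem_filter.1 this).2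
  obtain ⟨f₂, hf₂, -⟩ := hf₁.process hg hψ hX hXdeg W (Finset.subset_insert _ _) (by
    intro S f' hf' hS _ hff' z hz hzS
    have hcol' : ∀ y, G.Adj v y → f' y ≠ none := fun y hy => by
      obtain ⟨c, hc⟩ := Option.ne_none_iff_exists'.1 (hf₁col y hy)
      simp [hff' y c hc]
    have hfv : f' v ≠ none := by simp [hf'.apply_mem v (Finset.mem_insert_self _ _)]
    obtain ⟨w, hw, hwz⟩ := Finset.exists_mem_ne (by omega : 1 < W.card) z
    refine Or.inr (Or.inr (Or.inl ⟨w, Finset.mem_insert_of_mem hw, hwz, fun x y hc => ?_⟩))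
    obtain ⟨p, hvp, hpz⟩ := hesurj z hz
    obtain ⟨q, hvq, hqw⟩ := hesurj w hw
    have hpq : p ≠ q := fun h => hwz (by rw [← hpz, ← hqw, h])
    have hvz : v ≠ z := fun h => hvW (h ▸ hz)
    have hvw : v ≠ w := fun h => hvW (h ▸ hw)
    have hep := he p (hcol p hvp)
    have heq := he q (hcol q hvq)
    rw [hpz] at hep
    rw [hqw] at heq
    obtain ⟨-, ⟨hpW, hpe⟩ | ⟨hpW, hpe⟩⟩ := hep <;> obtain ⟨-, ⟨hqW, hqe⟩ | ⟨hqW, hqe⟩⟩ := heq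
    · have := hc.eq_of_path hg hf' hzS hfv (l := [w])
        (by simp [hqe, hpe, hvp.symm, hvq]) (by simp [hvz.symm, hvw, hwz.symm]) (by simp) (by simp)
      simp at this
    · have hzq : z ≠ q := hpe ▸ hpq
      have := hc.eq_of_path hg hf' hzS hfv (l := [q, w]) (by simp [hpe, hvp.symm, hvq, hqe])
        (by simp [hvz.symm, hzq, hwz.symm, hvq.ne, hvw, hqe.ne]) (by simp) (by simp)
      simp at this
    · have hpw : p ≠ w := hqe ▸ hpq
      have := hc.eq_of_path hg hf' hzS (hcol' p hvp) (l := [v, w])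
        (by simp [hqe, hpe.symm, hvp.symm, hvq])
        (by simp [hpe.ne', hvz.symm, hwz.symm, hvp.ne', hpw, hvw]) (by simp) (by simp)
      simp at this
    · have hpw : p ≠ w := fun h => hpW (h ▸ hw)
      have hzq : z ≠ q := fun h => hqW (h ▸ hz)
      have := hc.eq_of_path hg hf' hzS (hcol' p hvp) (l := [v, q, w])
        (by simp [hvp.symm, hpe.symm, hvq, hqe])
        (by simp [hpe.ne', hvz.symm, hzq, hwz.symm, hvp.ne', hpq, hpw, hvq.ne, hvw, hqe.ne])
        (by simp) (by simp)
      simp at this)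
  have hS : ({v} : Finset V) ∪ W = insert v W := (Finset.insert_eq v W).symm
  rw [show insert v (∅ : Finset V) = {v} from rfl, hS] at hf₂
  exact hf₂.exists_isBColoring hψ hX hXout

/-- A vertex left uncolored by some optimal proper extension of `f`. -/
def Deficient [Fintype V] {N : ℕ} (G : SimpleGraph V) (f : V → Option (Fin N)) (v : V) : Prop :=
  ∃ g, IsMinExt G f g ∧ g v = none

theorem Deficient.eq_none [Fintype V] {N : ℕ} {f : V → Option (Fin N)} {v : V}
    (h : Deficient G f v) : f v = none := by
  obtain ⟨g, hg, hv⟩ := h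
  by_contra hf
  obtain ⟨c, hc⟩ := Option.ne_none_iff_exists'.1 hf
  simp [hg.1.2 v c hc] at hv

/-- The defect can be moved to any neighbor that is not colored by `f`. -/
theorem Deficient.of_adj [Fintype V] [DecidableRel G.Adj] {N : ℕ} {f : V → Option (Fin N)}
    {u v : V} (h : Deficient G f v) (hdeg : G.degree v ≤ N) (huv : G.Adj v u) (hu : f u = none) :
    Deficient G f u := by
  classical
  have hfv := h.eq_none
  obtain ⟨g, hg, hv⟩ := h
  obtain ⟨-, hinj⟩ := hg.neighbors hv hdeg
  have hval : ∀ x c, g (Equiv.swap v u x) = some c → (x = v ∧ g u = some c) ∨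
      (x ≠ v ∧ x ≠ u ∧ g x = some c) := by
    intro x c hx
    by_cases hxv : x = v
    · subst hxv
      exact Or.inl ⟨rfl, by simpa using hx⟩
    · by_cases hxu : x = u
      · subst hxu
        simp [hv] at hx
      · rw [Equiv.swap_apply_of_ne_of_ne hxv hxu] at hx
        exact Or.inr ⟨hxv, hxu, hx⟩
  have hcard : ∀ g' : V → Option (Fin N),
      (Finset.univ.filter fun x => g' (Equiv.swap v u x) = none).card =
      (Finset.univ.filter fun x => g' x = none).card := fun g' =>
    Finset.card_equiv (Equiv.swap v u) (by simp)
  refine ⟨fun x => g (Equiv.swap v u x), ⟨⟨?_, ?_⟩, ?_⟩, by simpa using hv⟩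
  · intro a b hab c ha hb
    rcases hval a c ha with ⟨rfl, ha'⟩ | ⟨hav, hau, ha'⟩ <;>
      rcases hval b c hb with ⟨rfl, hb'⟩ | ⟨hbv, hbu, hb'⟩
    · exact hab.ne rfl
    · exact hbu (hinj b u hab huv (hb'.trans ha'.symm))
    · exact hau (hinj a u hab.symm huv (ha'.trans hb'.symm))
    · exact hg.1.1 a b hab c ha' hb'
  · intro x c hx
    have hxv : x ≠ v := by
      rintro rfl
      simp [hfv] at hx
    have hxu : x ≠ u := by
      rintro rfl
      simp [hu] at hx
    simpa [Equiv.swap_apply_of_ne_of_ne hxv hxu] using hg.1.2 x c hx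
  · intro g' hg'
    rw [hcard]
    exact hg.2 g' hg'

theorem exists_isBColoring_or [Fintype V] [DecidableRel G.Adj] (hg : 9 ≤ G.egirth) {k : ℕ}
    (hk : 3 ≤ k) {W : Finset V} (hW : W.card = k) (hWdeg : ∀ z ∈ W, k ≤ G.degree z)
    (hout : ∀ v, v ∉ W → G.degree v ≤ k) :
    (∃ C, IsBColoring G k C) ∨ ∃ C, IsBColoring G (k + 1) C := by
  classical
  by_contra! hno
  obtain ⟨hno, hno'⟩ := hno
  have : Nonempty (Fin k) := ⟨⟨0, by omega⟩⟩
  obtain ⟨φ, hφ⟩ := exists_injOn_of_card W hW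
  obtain ⟨f, h₀⟩ := exists_partialBColoring_of_le_degree hg W hW hφ hWdeg
  have hnW : ∀ h, f h = none → h ∉ W := fun h hh => h₀.not_mem_of_eq_none hh
  have hdeg : ∀ h, Deficient G f h → G.degree h = k := fun h hh => by
    refine le_antisymm (hout h (hnW h hh.eq_none)) ?_
    obtain ⟨g, hg, hv⟩ := hh
    exact hg.le_degree hv
  -- A deficient vertex is joined to each vertex of `W` by a short path.
  have hpath : ∀ h, Deficient G f h → ∀ w ∈ W, Near G h w ∨ ∃ z x u, z ∈ W ∧ u ∈ W ∧ x ∉ W ∧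
      x ≠ h ∧ G.Adj h z ∧ G.Adj z x ∧ G.Adj x u ∧ G.Adj u w := by
    intro h hh w hw
    by_contra! hcon
    obtain ⟨hnear, hcon⟩ := hcon
    obtain ⟨C, hC⟩ := exists_isBColoring_of_not_near (X := insert h W) (N := k + 1) hg
      (by rw [Finset.card_insert_of_notMem (hnW h hh.eq_none), hW]) (by
        intro z hz
        rcases Finset.mem_insert.1 hz with rfl | hz
        · rw [hdeg z hh]
        · have := hWdeg z hz
          omega)
      (fun v hv => Nat.lt_succ_of_le (hout v fun hv' => hv (Finset.mem_insert_of_mem hv')))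
      (Finset.mem_insert_self _ _) (Finset.mem_insert_of_mem hw) hnear (by
        intro z x u hz hx hu hhz hzx hxu huw
        rw [Finset.mem_insert] at hz hx hu
        push Not at hx
        refine hcon z x u (hz.resolve_left hhz.ne') (hu.resolve_left ?_) hx.2 hx.1 hhz hzx hxu huw
        rintro rfl
        exact not_adj_of_adj_adj hg hhz hzx hxu.symm)
    exact hno' C hC
  have hnear : ∀ h h', Deficient G f h → G.Adj h h' → f h' = none → ∀ w ∈ W, Near G h w := by
    intro h h' hh hadj hf' w hw
    have hh' := hh.of_adj (hdeg h hh).le hadj hf'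
    have hhW := hnW h hh.eq_none
    have hh'W := hnW h' hf'
    by_contra hhw
    obtain ⟨z, x, u, hz, hu, hxW, hxh, hhz, hzx, hxu, huw⟩ :=
      (hpath h hh w hw).resolve_left hhw
    have hzu : z ≠ u := by
      rintro rfl
      exact hhw (Or.inr (Or.inr (Or.inl ⟨z, hhz, huw⟩)))
    have hne : ∀ {a b : V}, a ∉ W → b ∈ W → a ≠ b := fun ha hb hab => ha (hab ▸ hb)
    have hh'x : h' ≠ x := by
      rintro rfl
      exact not_adj_of_adj_adj hg hhz hzx hadj
    have hc : List.IsChain G.Adj (h' :: [h, z, x, u]) := by simp [hadj.symm, hhz, hzx, hxu]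
    have hn : (h' :: [h, z, x, u]).Nodup := by
      simp [hadj.ne', hne hh'W hz, hh'x, hne hh'W hu, hne hhW hz, hxh.symm, hne hhW hu, hzx.ne,
        hzu, hxu.ne]
    rcases hpath h' hh' u hu with hnear | ⟨z', x', u', hz', hu', hxW', hxh', hhz', hzx', hxu', huw'⟩
    · have := hnear.length_eq_of_isChain hg hc hn (by simp) (by simp)
      simp at this
    · have hnot : ¬ Near G h' u := fun hnear => by
        have := hnear.length_eq_of_isChain hg hc hn (by simp) (by simp)
        simp at this
      have hzu' : z' ≠ u' := by
        rintro rfl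
        exact hnot (Or.inr (Or.inr (Or.inl ⟨z', hhz', huw'⟩)))
      have hzu'' : z' ≠ u := by
        rintro rfl
        exact hnot (Or.inr (Or.inl hhz'))
      have := path_list_unique hg (l₁ := [h, z, x, u]) (l₂ := [z', x', u', u]) hc
        (by simp [hhz', hzx', hxu', huw']) hn
        (by simp [hne hh'W hz', hxh'.symm, hne hh'W hu', hne hh'W hu, hzx'.ne, hzu', hzu'',
          hxu'.ne, hne hxW' hu, huw'.ne]) (by simp) (by simp)
      simp only [List.cons.injEq] at this
      exact hhW (this.1 ▸ hz')
  obtain ⟨g, hgmin⟩ := h₀.properExt.exists_isMinExt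
  obtain ⟨v, hv⟩ : ∃ v, g v = none := by
    by_contra! htot
    obtain ⟨C, hC⟩ := h₀.isBColoring_of_total hφ hW hgmin.1 htot
    exact hno C hC
  have hvD : Deficient G f v := ⟨g, hgmin, hv⟩
  by_cases hiso : ∀ y, G.Adj v y → f y ≠ none
  · obtain ⟨C, hC⟩ := exists_isBColoring_of_isolated hg (by omega) hW hφ h₀ hWdeg hout hvD.eq_none
      (hdeg v hvD) hiso (fun c => by
        obtain ⟨y, hy, hgy⟩ := hgmin.exists_adj hv c
        obtain ⟨d, hd⟩ := Option.ne_none_iff_exists'.1 (hiso y hy)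
        refine ⟨y, hy, ?_⟩
        rw [hd, ← hgmin.1.2 y d hd, hgy])
    exact hno' C hC
  · push Not at hiso
    obtain ⟨v', hvv', hfv'⟩ := hiso
    let K : SimpleGraph V :=
      { Adj := fun a b => G.Adj a b ∧ f a = none ∧ f b = none
        symm := ⟨fun a b h => ⟨h.1.symm, h.2.2, h.2.1⟩⟩
        loopless := ⟨fun a h => h.1.ne rfl⟩ }
    have hreach : ∀ a b, K.Walk a b → Deficient G f a ∧ (∃ a', K.Adj a a') →
        Deficient G f b ∧ ∃ b', K.Adj b b' := by
      intro a b p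
      induction p with
      | nil => exact id
      | cons hac p ih =>
        rintro ⟨ha, -⟩
        exact ih ⟨ha.of_adj (hdeg _ ha).le hac.1 hac.2.2, _, hac.symm⟩
    refine false_of_component hg hk hW h₀ (K := K) (fun _ _ => Iff.rfl) (v := v) fun h hh => ?_
    obtain ⟨p⟩ := hh
    obtain ⟨hD, h', hh'⟩ := hreach v h p ⟨hvD, v', hvv', hvD.eq_none, hfv'⟩
    exact ⟨⟨h', hh'⟩, hdeg h hD, hnear h h' hD hh'.1 hh'.2.2⟩

end

/-- If `G` is a finite simple graph with girth at least 9, then `χ_b(G) ≥ m(G) - 1`. -/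
theorem bChromatic_ge_of_girth_ge_nine {V : Type*} [Fintype V] (G : SimpleGraph V)
    [DecidableRel G.Adj] (hg : 9 ≤ G.egirth) :
    mParam G - 1 ≤ bChromatic G := by
  classical
  have hD := mParam_le_card G
  have hB := card_mParam_le_degree G
  generalize hm : mParam G = m at hD hB
  obtain ⟨n, hn, hcol⟩ := exists_le_bChromatic_colorable G
  rcases le_or_gt 4 m with h4 | h4
  · rcases eq_or_lt_of_le hB with hB | hB
    · have : Nonempty (Fin m) := ⟨⟨0, by omega⟩⟩
      obtain ⟨φ, hφ⟩ := exists_injOn_of_card _ hB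
      obtain ⟨f, hf⟩ := exists_partialBColoring_of_le_degree hg _ hB hφ (by simp)
      obtain ⟨C, hC⟩ := hf.exists_isBColoring hφ hB (by simp)
      exact (Nat.sub_le _ _).trans hC.le_bChromatic
    · obtain ⟨W, hBW, hWD, hW⟩ := Finset.exists_subsuperset_card_eq
        (s := Finset.univ.filter fun v => m ≤ G.degree v)
        (t := Finset.univ.filter fun v => m - 1 ≤ G.degree v) (n := m - 1)
        (Finset.monotone_filter_right _ fun v _ hv => (Nat.sub_le _ _).trans hv)
        (by omega) (by omega)
      rcases exists_isBColoring_or hg (by omega) hW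
        (fun z hz => (Finset.mem_filter.1 (hWD hz)).2)
        (fun v hv => by
          by_contra hlt
          exact hv (hBW (by simp; omega))) with ⟨C, hC⟩ | ⟨C, hC⟩
      · exact hC.le_bChromatic
      · exact (Nat.le_succ _).trans hC.le_bChromatic
  · by_contra! hlt
    have hn' : n < m - 1 := hn.trans_lt hlt
    obtain ⟨C⟩ := hcol
    obtain ⟨v, hv⟩ := Finset.card_pos.1 (lt_of_lt_of_le (by omega) hD)
    have hvdeg := (Finset.mem_filter.1 hv).2
    obtain ⟨u, hu⟩ := (G.degree_pos_iff_exists_adj v).1 (by omega)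
    have hne := C.valid hu
    have h₁ := (C v).isLt
    have h₂ := (C u).isLt
    exact hne (Fin.ext (by omega))
end

section
/- Let G be a finite simple graph with girth at least 9. If G has a good set, then the b-chromatic number of G equals m(G). -/
open SimpleGraph Finset

namespace SimpleGraph

variable {V : Type*} {G : SimpleGraph V}

/-- A sequence of vertices that follows edges and repeats no vertex except possibly the last
one is traced by a path. -/
theorem exists_isPath_of_injOn (f : ℕ → V) (n : ℕ) (hadj : ∀ i < n, G.Adj (f i) (f (i + 1)))
    (hinj : ∀ i j, i < j → j ≤ n → f i ≠ f j) :
    ∃ p : G.Walk (f 0) (f n), p.IsPath ∧ p.length = n ∧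
      (∀ x ∈ p.support, ∃ i ≤ n, x = f i) ∧
      ∀ e ∈ p.edges, ∃ i < n, e = s(f i, f (i + 1)) := by
  induction n with
  | zero => exact ⟨.nil, by simp, by simp, by simp, by simp⟩
  | succ n ih =>
    obtain ⟨p, hp, hl, hs, he⟩ := ih (fun i hi => hadj i (by omega))
      (fun i j hij hj => hinj i j hij (by omega))
    refine ⟨p.concat (hadj n (by omega)), hp.concat (fun hmem => ?_) _, by simp [hl], ?_, ?_⟩
    · obtain ⟨i, hi, h⟩ := hs _ hmem
      exact hinj i (n + 1) (by omega) le_rfl h.symm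
    · intro x hx
      rw [Walk.support_concat, List.mem_append] at hx
      rcases hx with hx | hx
      · obtain ⟨i, hi, h⟩ := hs _ hx
        exact ⟨i, by omega, h⟩
      · exact ⟨n + 1, le_rfl, by simpa using hx⟩
    · intro e h
      rw [Walk.edges_concat, List.concat_eq_append, List.mem_append] at h
      rcases h with h | h
      · obtain ⟨i, hi, h⟩ := he _ h
        exact ⟨i, by omega, h⟩
      · exact ⟨n, by omega, by simpa using h⟩

/-- A closed walk shorter than the girth backtracks somewhere away from its base point. -/
theorem false_of_closed_nonbacktracking {g : ℕ} (hg : (g : ℕ∞) ≤ G.egirth) :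
    ∀ (k : ℕ) (f : ℕ → V), 0 < k → k < g → (∀ i < k, G.Adj (f i) (f (i + 1))) →
      (∀ i, i + 2 ≤ k → f i ≠ f (i + 2)) → f 0 = f k → False := by
  intro k
  induction k using Nat.strong_induction_on with
  | _ k ih =>
    intro f hk hkg hadj hnb hclosed
    have hinj : ∀ i j, i < j → j < k → f i ≠ f j := by
      intro i j hij hj h
      refine ih (j - i) (by omega) (fun t => f (i + t)) (by omega) (by omega)
        (fun t ht => hadj (i + t) (by omega)) (fun t ht => hnb (i + t) (by omega)) ?_
      simpa [Nat.add_sub_cancel' hij.le] using h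
    obtain ⟨n, rfl⟩ : ∃ n, k = n + 1 := ⟨k - 1, by omega⟩
    obtain ⟨p, hp, hl, -, he⟩ := exists_isPath_of_injOn f n
      (fun i hi => hadj i (by omega)) (fun i j hij hj => hinj i j hij (by omega))
    have hlast : G.Adj (f n) (f 0) := hclosed ▸ hadj n (by omega)
    have hcyc : (Walk.cons hlast p).IsCycle := by
      rw [Walk.cons_isCycle_iff]
      refine ⟨hp, fun hmem => ?_⟩
      obtain ⟨i, hi, h⟩ := he _ hmem
      have hn2 : n ≠ 1 := by
        rintro rfl
        exact hnb 0 le_rfl hclosed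
      rw [Sym2.eq_iff] at h
      rcases h with ⟨h, -⟩ | ⟨h, h'⟩
      · exact hinj i n hi (by omega) h.symm
      · rcases Nat.eq_zero_or_pos i with rfl | hi0
        · exact hinj 1 n (by omega) (by omega) h.symm
        · exact hinj 0 i hi0 (by omega) h'
    have := hg.trans (le_egirth.mp le_rfl _ _ hcyc)
    rw [Walk.length_cons, hl] at this
    have : g ≤ n + 1 := by exact_mod_cast this
    omega

theorem not_triangle_of_egirth (hg : 9 ≤ G.egirth) {a b c : V} (ab : G.Adj a b)
    (bc : G.Adj b c) (ca : G.Adj c a) : False := by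
  refine false_of_closed_nonbacktracking (g := 9) hg 3
    (fun i => [a, b, c].getD i a) (by omega) (by omega) ?_ ?_ rfl
  · intro i hi; interval_cases i <;> assumption
  · intro i hi
    have : i ≤ 1 := by omega
    interval_cases i
    · exact ca.ne'
    · exact ab.ne'

theorem not_closed_four_of_egirth (hg : 9 ≤ G.egirth) {a b c d : V} (ab : G.Adj a b)
    (bc : G.Adj b c) (cd : G.Adj c d) (da : G.Adj d a) (hac : a ≠ c) (hbd : b ≠ d) : False := by
  refine false_of_closed_nonbacktracking (g := 9) hg 4
    (fun i => [a, b, c, d].getD i a) (by omega) (by omega) ?_ ?_ rfl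
  · intro i hi; interval_cases i <;> assumption
  · intro i hi
    have : i ≤ 2 := by omega
    interval_cases i
    · exact hac
    · exact hbd
    · exact hac.symm

theorem not_closed_five_of_egirth (hg : 9 ≤ G.egirth) {a b c d e : V} (ab : G.Adj a b)
    (bc : G.Adj b c) (cd : G.Adj c d) (de : G.Adj d e) (ea : G.Adj e a)
    (hac : a ≠ c) (hbd : b ≠ d) (hce : c ≠ e) (hda : d ≠ a) : False := by
  refine false_of_closed_nonbacktracking (g := 9) hg 5
    (fun i => [a, b, c, d, e].getD i a) (by omega) (by omega) ?_ ?_ rfl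
  · intro i hi; interval_cases i <;> assumption
  · intro i hi
    have : i ≤ 3 := by omega
    interval_cases i <;> assumption

theorem not_closed_six_of_egirth (hg : 9 ≤ G.egirth) {a b c d e f : V} (ab : G.Adj a b)
    (bc : G.Adj b c) (cd : G.Adj c d) (de : G.Adj d e) (ef : G.Adj e f) (fa : G.Adj f a)
    (hac : a ≠ c) (hbd : b ≠ d) (hce : c ≠ e) (hdf : d ≠ f) (hea : e ≠ a) : False := by
  refine false_of_closed_nonbacktracking (g := 9) hg 6
    (fun i => [a, b, c, d, e, f].getD i a) (by omega) (by omega) ?_ ?_ rfl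
  · intro i hi; interval_cases i <;> assumption
  · intro i hi
    have : i ≤ 4 := by omega
    interval_cases i <;> assumption

theorem not_closed_seven_of_egirth (hg : 9 ≤ G.egirth) {a b c d e f h : V} (ab : G.Adj a b)
    (bc : G.Adj b c) (cd : G.Adj c d) (de : G.Adj d e) (ef : G.Adj e f) (fh : G.Adj f h)
    (ha : G.Adj h a) (hac : a ≠ c) (hbd : b ≠ d) (hce : c ≠ e) (hdf : d ≠ f) (heh : e ≠ h)
    (hfa : f ≠ a) : False := by
  refine false_of_closed_nonbacktracking (g := 9) hg 7
    (fun i => [a, b, c, d, e, f, h].getD i a) (by omega) (by omega) ?_ ?_ rfl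
  · intro i hi; interval_cases i <;> assumption
  · intro i hi
    have : i ≤ 5 := by omega
    interval_cases i <;> assumption

theorem not_closed_eight_of_egirth (hg : 9 ≤ G.egirth) {a b c d e f h k : V} (ab : G.Adj a b)
    (bc : G.Adj b c) (cd : G.Adj c d) (de : G.Adj d e) (ef : G.Adj e f) (fh : G.Adj f h)
    (hk : G.Adj h k) (ka : G.Adj k a) (hac : a ≠ c) (hbd : b ≠ d) (hce : c ≠ e) (hdf : d ≠ f)
    (heh : e ≠ h) (hfk : f ≠ k) (hha : h ≠ a) : False := by
  refine false_of_closed_nonbacktracking (g := 9) hg 8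
    (fun i => [a, b, c, d, e, f, h, k].getD i a) (by omega) (by omega) ?_ ?_ rfl
  · intro i hi; interval_cases i <;> assumption
  · intro i hi
    have : i ≤ 6 := by omega
    interval_cases i <;> assumption

/-- A proper coloring of `A` by `W` extends to the whole graph when every other vertex has
fewer than `#W` neighbors. -/
theorem exists_proper_extension [Fintype V] [DecidableRel G.Adj] (W : Finset V) (A : Set V)
    (c : V → V) (hcW : ∀ x ∈ A, c x ∈ W)
    (hc : ∀ x ∈ A, ∀ y ∈ A, G.Adj x y → c x ≠ c y) (hdeg : ∀ x ∉ A, G.degree x < W.card) :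
    ∃ c' : V → V, (∀ x, c' x ∈ W) ∧ (∀ x y, G.Adj x y → c' x ≠ c' y) ∧
      ∀ x ∈ A, c' x = c x := by
  classical
  have key : ∀ B : Finset V, ∃ c' : V → V, (∀ x ∈ A ∪ B, c' x ∈ W) ∧
      (∀ x ∈ A ∪ B, ∀ y ∈ A ∪ B, G.Adj x y → c' x ≠ c' y) ∧ ∀ x ∈ A, c' x = c x := by
    intro B
    induction B using Finset.induction_on with
    | empty => exact ⟨c, by simpa using hcW, by simpa using hc, fun _ _ => rfl⟩
    | insert b B _ ih =>
      obtain ⟨c', h1, h2, h3⟩ := ih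
      by_cases hb : b ∈ A
      · have : A ∪ ((insert b B : Finset V) : Set V) = A ∪ B := by
          ext x; simp only [coe_insert, Set.mem_union, Set.mem_insert_iff]; grind
        rw [this]
        exact ⟨c', h1, h2, h3⟩
      obtain ⟨w, hwW, hw⟩ : ∃ w ∈ W, w ∉ (G.neighborFinset b).image c' := by
        apply Finset.exists_mem_notMem_of_card_lt_card
        exact card_image_le.trans_lt (by simpa using hdeg b hb)
      have hw' : ∀ y, G.Adj b y → c' y ≠ w := by
        intro y hy h
        exact hw (mem_image.mpr ⟨y, by simpa using hy, h⟩)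
      refine ⟨Function.update c' b w, ?_, ?_, ?_⟩
      · intro x hx
        by_cases hxb : x = b
        · simpa [hxb] using hwW
        · rw [Function.update_of_ne hxb]
          apply h1
          simpa [hxb] using hx
      · intro x hx y hy hxy
        by_cases hxb : x = b
        · subst hxb
          rw [Function.update_self, Function.update_of_ne hxy.ne']
          exact (hw' y hxy).symm
        · by_cases hyb : y = b
          · subst hyb
            rw [Function.update_self, Function.update_of_ne hxy.ne]
            exact hw' x hxy.symm
          · rw [Function.update_of_ne hxb, Function.update_of_ne hyb]
            exact h2 x (by simpa [hxb] using hx) y (by simpa [hyb] using hy) hxy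
      · intro x hx
        rw [Function.update_of_ne (by rintro rfl; exact hb hx)]
        exact h3 x hx
  obtain ⟨c', h1, h2, h3⟩ := key univ
  exact ⟨c', fun x => h1 x (by simp), fun x y => h2 x (by simp) y (by simp), h3⟩

end SimpleGraph

/-- A finset of size at least `#R` can be mapped into `T ⊇ R` so as to cover `R`. -/
theorem Finset.exists_mapsTo_covering {α β : Type*} [Nonempty β] (F : Finset α) (R T : Finset β)
    (hRT : R ⊆ T) (hcard : R.card ≤ F.card) (hT : F.Nonempty → T.Nonempty) :
    ∃ g : α → β, (∀ y ∈ F, g y ∈ T) ∧ ∀ r ∈ R, ∃ y ∈ F, g y = r := by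
  classical
  obtain ⟨t, ht⟩ : ∃ t, F.Nonempty → t ∈ T := by
    by_cases hF : F.Nonempty
    · obtain ⟨t, ht⟩ := hT hF
      exact ⟨t, fun _ => ht⟩
    · exact ⟨Classical.arbitrary β, fun h => absurd h hF⟩
  obtain ⟨F', hF', hcard'⟩ := Finset.exists_subset_card_eq hcard
  let e := Finset.equivOfCardEq hcard'
  refine ⟨fun y => if h : y ∈ F' then (e ⟨y, h⟩ : β) else t, ?_, ?_⟩
  · intro y hy
    by_cases h : y ∈ F'
    · simpa [h] using hRT (e ⟨y, h⟩).2
    · simpa [h] using ht ⟨y, hy⟩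
  · intro r hr
    refine ⟨e.symm ⟨r, hr⟩, hF' (e.symm ⟨r, hr⟩).2, ?_⟩
    simp

namespace GoodSet

section

variable {V : Type*} (G : SimpleGraph V) (W : Finset V)

/-- A vertex outside `W` with at least two neighbors in `W`. -/
def IsLink (x : V) : Prop :=
  x ∉ W ∧ ∃ v ∈ W, ∃ w ∈ W, v ≠ w ∧ G.Adj x v ∧ G.Adj x w

/-- `u ∈ W` is joined to `x` by a path of length two whose midpoint is outside `W`. -/
def Reaches (x u : V) : Prop :=
  u ∈ W ∧ ∃ z ∉ W, G.Adj x z ∧ G.Adj z u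

/-- `u ∈ W` is joined to `x` by the path `x, v, y, u` with `v ∈ W` and `y ∉ W`. -/
structure Detour (x v y u : V) : Prop where
  mid_mem : v ∈ W
  mem : u ∈ W
  mid_notMem : y ∉ W
  ne_mid : u ≠ v
  ne_start : y ≠ x
  adj_start : G.Adj x v
  adj_mid : G.Adj v y
  adj_end : G.Adj y u

/-- A link that reaches nothing and shares none of its neighbors in `W` with another link. -/
def IsLonely (x : V) : Prop :=
  IsLink G W x ∧ (∀ u, ¬ Reaches G W x u) ∧
    ∀ v ∈ W, G.Adj x v → ∀ y, IsLink G W y → G.Adj y v → y = x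

/-- A neighbor of `v` outside `W` with no other neighbor in `W` that reaches nothing. -/
def IsFree (v x : V) : Prop :=
  x ∉ W ∧ G.Adj v x ∧ (∀ w ∈ W, G.Adj x w → w = v) ∧ ∀ u, ¬ Reaches G W x u

/-- The colors allowed for the vertices of `W` and their neighbors that are not free. Vertices
that reach `W` use the color `d x`, except that they give it up to a lonely link that needs it;
lonely links use the color `e x`; other links that reach nothing use a color of the next link
in the cyclic order `σ v` around a common neighbor `v`. -/
inductive Allows (d e : V → V) (σ : V → Equiv.Perm V) : V → V → Prop
  | own {x : V} (hx : x ∈ W) : Allows d e σ x x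
  | reach {x : V} (hx : x ∉ W) (hr : Reaches G W x (d x))
      (hd : ∀ l v, IsLonely G W l → v ∈ W → G.Adj l v → G.Adj x v → d x ≠ e l) :
      Allows d e σ x (d x)
  | swap {x l v u : V} (hx : x ∉ W) (hr : Reaches G W x (d x)) (hl : IsLonely G W l)
      (hde : d x = e l) (hu : Detour G W x v l u) : Allows d e σ x u
  | cyclic {x v u : V} (hx : IsLink G W x) (hr : ∀ u, ¬ Reaches G W x u)
      (hl : ¬ IsLonely G W x) (hu : Detour G W x v (σ v x) u) : Allows d e σ x u
  | lonely {x : V} (hl : IsLonely G W x) : Allows d e σ x (e x)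

variable {G W} {d e : V → V} {σ : V → Equiv.Perm V} {u v w x y l l' : V}

theorem Reaches.not_adj (hg : 9 ≤ G.egirth) (h : Reaches G W x u) : ¬ G.Adj x u := by
  obtain ⟨-, z, -, h1, h2⟩ := h
  exact fun h => not_triangle_of_egirth hg h1 h2 h.symm

theorem Detour.not_adj (hg : 9 ≤ G.egirth) (h : Detour G W x v y u) : ¬ G.Adj x u := fun h' =>
  not_closed_four_of_egirth hg h.adj_start h.adj_mid h.adj_end h'.symm h.ne_start.symm
    h.ne_mid.symm

theorem Allows.mem_and_not_adj (hg : 9 ≤ G.egirth)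
    (he : ∀ x ∉ W, e x ∈ W ∧ ¬ G.Adj x (e x)) (h : Allows G W d e σ x u) :
    u ∈ W ∧ (x ∉ W → ¬ G.Adj x u) := by
  cases h with
  | own hx => exact ⟨hx, fun h => absurd hx h⟩
  | reach hx hr hd => exact ⟨hr.1, fun _ => hr.not_adj hg⟩
  | swap hx hr hl hde hu => exact ⟨hu.mem, fun _ => hu.not_adj hg⟩
  | cyclic hx hr hl hu => exact ⟨hu.mem, fun _ => hu.not_adj hg⟩
  | lonely hl => exact ⟨(he x hl.1.1).1, fun h => (he x h).2⟩

/-! ### Adjacent vertices outside `W` -/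

theorem Reaches.false_of_adj_reaches (hg : 9 ≤ G.egirth) (hx : x ∉ W) (hy : y ∉ W)
    (hxy : G.Adj x y) (h : Reaches G W x u) (h' : Reaches G W y u) : False := by
  obtain ⟨hu, z, hz, h1, h2⟩ := h
  obtain ⟨-, z', hz', h3, h4⟩ := h'
  by_cases hzy : z = y
  · subst hzy
    exact not_triangle_of_egirth hg h3 h4 h2.symm
  · exact not_closed_five_of_egirth hg h2.symm h1.symm hxy h3 h4 (by grind) hzy
      (by rintro rfl; exact not_triangle_of_egirth hg h1 h2 h4.symm) (by grind)

theorem Reaches.false_of_adj_detour (hg : 9 ≤ G.egirth) (hx : x ∉ W) (hy : y ∉ W)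
    (hxy : G.Adj x y) (h : Reaches G W x u) (h' : Detour G W y v w u) : False := by
  obtain ⟨hu, z, hz, h1, h2⟩ := h
  by_cases hzy : z = y
  · subst hzy
    exact h'.not_adj hg h2
  · exact not_closed_six_of_egirth hg h2.symm h1.symm hxy h'.adj_start h'.adj_mid h'.adj_end
      (by grind) hzy (by have := h'.mid_mem; grind) h'.ne_start.symm h'.ne_mid.symm

theorem Detour.false_of_adj_detour (hg : 9 ≤ G.egirth) (hx : x ∉ W) (hy : y ∉ W)
    (hxy : G.Adj x y) {w' v' : V} (h : Detour G W x v w u) (h' : Detour G W y v' w' u) :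
    False :=
  not_closed_seven_of_egirth hg h.adj_end.symm h.adj_mid.symm h.adj_start.symm hxy h'.adj_start
    h'.adj_mid h'.adj_end h.ne_mid h.ne_start (by have := h.mid_mem; grind)
    (by have := h'.mid_mem; grind) h'.ne_start.symm h'.ne_mid.symm

theorem Allows.false_of_adj (hg : 9 ≤ G.egirth) (hx : x ∉ W) (hy : y ∉ W) (hxy : G.Adj x y)
    (hxW : ∃ w ∈ W, G.Adj x w) (hyW : ∃ w ∈ W, G.Adj y w)
    (h : Allows G W d e σ x u) (h' : Allows G W d e σ y u) : False := by
  obtain ⟨w, hw, hxw⟩ := hxW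
  obtain ⟨w', hw', hyw'⟩ := hyW
  have rx : Reaches G W x w' := ⟨hw', y, hy, hxy, hyw'⟩
  have ry : Reaches G W y w := ⟨hw, x, hx, hxy.symm, hxw⟩
  have key : ∀ {a b : V}, a ∉ W → Reaches G W a b → Allows G W d e σ a u →
      Reaches G W a u ∨ ∃ v l, Detour G W a v l u := by
    intro a b ha hab h
    cases h with
    | own h => exact absurd h ha
    | reach _ hr _ => exact .inl hr
    | swap _ _ _ _ hu => exact .inr ⟨_, _, hu⟩
    | cyclic _ hr => exact absurd hab (hr _)
    | lonely hl => exact absurd hab (hl.2.1 _)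
  rcases key hx rx h with h | ⟨_, _, h⟩ <;> rcases key hy ry h' with h' | ⟨_, _, h'⟩
  · exact h.false_of_adj_reaches hg hx hy hxy h'
  · exact h.false_of_adj_detour hg hx hy hxy h'
  · exact h'.false_of_adj_detour hg hy hx hxy.symm h
  · exact h.false_of_adj_detour hg hx hy hxy h'

/-! ### Neighbors of a common vertex of `W` -/

theorem Reaches.eq_of_common_neighbor (hg : 9 ≤ G.egirth) (hv : v ∈ W) (hx : x ∉ W) (hy : y ∉ W)
    (hvx : G.Adj v x) (hvy : G.Adj v y) (h : Reaches G W x u) (h' : Reaches G W y u) :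
    x = y := by
  by_contra hne
  obtain ⟨hu, z, hz, h1, h2⟩ := h
  obtain ⟨-, z', hz', h3, h4⟩ := h'
  exact not_closed_six_of_egirth hg h2.symm h1.symm hvx.symm hvy h3 h4
    (by grind) (by grind) hne (by grind) (by grind)

theorem Reaches.eq_of_common_neighbor_detour (hg : 9 ≤ G.egirth) (hv : v ∈ W) (hx : x ∉ W)
    {v' : V} (hvx : G.Adj v x) (hvy : G.Adj v y) (h : Reaches G W x u)
    (h' : Detour G W y v' w u) : x = y := by
  by_contra hne
  obtain ⟨hu, z, hz, h1, h2⟩ := h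
  have hw := h'.mid_notMem
  by_cases hv' : v' = v
  · subst hv'
    by_cases hwx : w = x
    · subst hwx
      exact not_triangle_of_egirth hg h1 h2 h'.adj_end.symm
    · exact not_closed_five_of_egirth hg h2.symm h1.symm hvx.symm h'.adj_mid h'.adj_end
        (by grind) (by grind) (Ne.symm hwx) h'.ne_mid.symm
  · exact not_closed_seven_of_egirth hg h2.symm h1.symm hvx.symm hvy h'.adj_start h'.adj_mid
      h'.adj_end (by grind) (by grind) hne (Ne.symm hv') h'.ne_start.symm h'.ne_mid.symm

/-- Distinct neighbors of `v` with detours to the same vertex make the same detour via `v`. -/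
theorem Detour.eq_of_common_neighbor (hg : 9 ≤ G.egirth)
    (hvx : G.Adj v x) (hvy : G.Adj v y) (hne : x ≠ y) {v₁ v₂ w₁ w₂ : V}
    (h : Detour G W x v₁ w₁ u) (h' : Detour G W y v₂ w₂ u) :
    v₁ = v ∧ v₂ = v ∧ w₁ = w₂ := by
  have via : ∀ {x y v₁ v₂ w₁ w₂ : V}, G.Adj v x → G.Adj v y → x ≠ y →
      Detour G W x v₁ w₁ u → Detour G W y v₂ w₂ u → v₁ = v → v₂ = v := by
    intro x y v₁ v₂ w₁ w₂ hvx hvy hne h h' hv₁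
    subst hv₁
    by_contra hv₂
    by_cases hw : w₁ = y
    · subst hw
      exact h'.not_adj hg h.adj_end
    · exact not_closed_six_of_egirth hg h.adj_end.symm h.adj_mid.symm hvy h'.adj_start h'.adj_mid
        h'.adj_end h.ne_mid hw (Ne.symm hv₂) h'.ne_start.symm h'.ne_mid.symm
  by_cases hv₁ : v₁ = v
  · have hv₂ := via hvx hvy hne h h' hv₁
    refine ⟨hv₁, hv₂, ?_⟩
    subst hv₁ hv₂
    by_contra hw
    exact not_closed_four_of_egirth hg h.adj_end.symm h.adj_mid.symm h'.adj_mid h'.adj_end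
      h.ne_mid hw
  · by_cases hv₂ : v₂ = v
    · exact absurd (via hvy hvx hne.symm h' h hv₂) hv₁
    · exact (not_closed_eight_of_egirth hg h.adj_end.symm h.adj_mid.symm h.adj_start.symm
        hvx.symm hvy h'.adj_start h'.adj_mid h'.adj_end h.ne_mid h.ne_start hv₁ hne
        (Ne.symm hv₂) h'.ne_start.symm h'.ne_mid.symm).elim

/-- Among the neighbors of `v`, a lonely link shares its color with no other vertex. -/
theorem Allows.eq_of_isLonely (he : ∀ x ∉ W, e x ∈ W ∧ ¬ G.Adj x (e x))
    (hv : v ∈ W) (hvx : G.Adj v x) (hvy : G.Adj v y) (hy : y ∉ W) (hl : IsLonely G W x)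
    (h : Allows G W d e σ y (e x)) : y = x := by
  have hlink : IsLink G W y → y = x := fun hy => hl.2.2 v hv hvx.symm y hy hvy.symm
  generalize hu : e x = u at h
  cases h with
  | own h => exact absurd h hy
  | reach _ _ hd => exact absurd hu.symm (hd x v hl hv hvx.symm hvy.symm)
  | @swap l v' _ _ _ hl' _ hdet =>
    by_cases hv' : v' = v
    · subst hv'
      have hlx := hl.2.2 v' hv hvx.symm l hl'.1 hdet.adj_mid.symm
      subst hlx hu
      exact absurd hdet.adj_end (he l hl.1.1).2
    · exact hlink ⟨hy, v', hdet.mid_mem, v, hv, hv', hdet.adj_start, hvy.symm⟩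
  | cyclic hx => exact hlink hx
  | lonely hl => exact hlink hl.1

theorem Allows.eq_of_common_neighbor (hg : 9 ≤ G.egirth)
    (he : ∀ x ∉ W, e x ∈ W ∧ ¬ G.Adj x (e x)) (hv : v ∈ W) (hx : x ∉ W) (hy : y ∉ W)
    (hvx : G.Adj v x) (hvy : G.Adj v y) (h : Allows G W d e σ x u)
    (h' : Allows G W d e σ y u) : x = y := by
  by_contra hne
  have swap_cyclic : ∀ {x y v₁ v₂ l : V}, G.Adj v x → G.Adj v y → x ≠ y →
      IsLonely G W l → Detour G W x v₁ l u → IsLink G W y → ¬ IsLonely G W y →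
      Detour G W y v₂ (σ v₂ y) u → False := by
    intro x y v₁ v₂ l hvx hvy hne hl h hlink hnl h'
    obtain ⟨rfl, rfl, -⟩ := h.eq_of_common_neighbor hg hvx hvy hne h'
    exact hnl (hl.2.2 _ hv h.adj_mid.symm y hlink hvy.symm ▸ hl)
  cases h with
  | own h => exact hx h
  | lonely hl => exact hne (h'.eq_of_isLonely he hv hvx hvy hy hl).symm
  | reach _ hr hd =>
    generalize hu : d x = u at h'
    cases h' with
    | own h => exact hy h
    | lonely hl =>
      exact hd y v hl hv hvy.symm hvx.symm hu
    | reach _ hr' _ => exact hne ((hu ▸ hr).eq_of_common_neighbor hg hv hx hy hvx hvy hr')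
    | swap _ _ _ _ hu' =>
      exact hne ((hu ▸ hr).eq_of_common_neighbor_detour hg hv hx hvx hvy hu')
    | cyclic _ _ _ hu' =>
      exact hne ((hu ▸ hr).eq_of_common_neighbor_detour hg hv hx hvx hvy hu')
  | swap _ hr hl hde hu =>
    cases h' with
    | own h => exact hy h
    | lonely hl' =>
      exact hne ((Allows.swap (σ := σ) hx hr hl hde hu).eq_of_isLonely he hv hvy hvx hx hl')
    | reach _ hr' _ =>
      exact hne (hr'.eq_of_common_neighbor_detour hg hv hy hvy hvx hu).symm
    | swap _ hr' hl' hde' hu' =>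
      obtain ⟨-, -, rfl⟩ := hu.eq_of_common_neighbor hg hvx hvy hne hu'
      exact hne (hr.eq_of_common_neighbor hg hv hx hy hvx hvy (hde.trans hde'.symm ▸ hr'))
    | cyclic hlink _ hnl hu' => exact swap_cyclic hvx hvy hne hl hu hlink hnl hu'
  | cyclic hlink hr hnl hu =>
    cases h' with
    | own h => exact hy h
    | lonely hl' =>
      exact hne ((Allows.cyclic (d := d) hlink hr hnl hu).eq_of_isLonely he hv hvy hvx hx hl')
    | reach _ hr' _ =>
      exact hne (hr'.eq_of_common_neighbor_detour hg hv hy hvy hvx hu).symm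
    | swap _ hr' hl' hde' hu' => exact swap_cyclic hvy hvx (Ne.symm hne) hl' hu' hlink hnl hu
    | cyclic _ _ _ hu' =>
      obtain ⟨rfl, rfl, hw⟩ := hu.eq_of_common_neighbor hg hvx hvy hne hu'
      exact hne ((σ _).injective hw)

/-- The color of a neighbor of `v` that is not lonely differs from those of the neighbors of `v`
in `W`. -/
theorem Allows.not_adj_of_not_isLonely (hg : 9 ≤ G.egirth) (hv : v ∈ W) (hx : x ∉ W)
    (hvx : G.Adj v x) (hl : ¬ IsLonely G W x) (h : Allows G W d e σ x u) : ¬ G.Adj v u := by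
  intro hvu
  have key : ∀ {v' w : V}, Detour G W x v' w u → False := by
    intro v' w hdet
    by_cases hv' : v' = v
    · subst hv'
      exact not_triangle_of_egirth hg hdet.adj_mid hdet.adj_end hvu.symm
    · have := hdet.mem
      exact not_closed_five_of_egirth hg hvu.symm hvx hdet.adj_start hdet.adj_mid hdet.adj_end
        (by grind) (Ne.symm hv') hdet.ne_start.symm hdet.ne_mid.symm
  cases h with
  | own h => exact hx h
  | lonely h => exact hl h
  | reach _ hr _ =>
    obtain ⟨hu, z, hz, h1, h2⟩ := hr
    exact not_closed_four_of_egirth hg hvx h1 h2 hvu.symm (by grind) (by grind)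
  | swap _ _ _ _ hu => exact key hu
  | cyclic _ _ _ hu => exact key hu

theorem Allows.eq_of_mem (h : Allows G W d e σ x u) (hx : x ∈ W) : u = x := by
  cases h with
  | own _ => rfl
  | reach h => exact absurd hx h
  | swap h => exact absurd hx h
  | cyclic h => exact absurd hx h.1
  | lonely h => exact absurd hx h.1.1

theorem Allows.eq_of_lonely (h : Allows G W d e σ x u) (hx : IsLonely G W x) : u = e x := by
  cases h with
  | own h => exact absurd h hx.1.1
  | reach _ hr => exact absurd hr (hx.2.1 _)
  | swap _ hr => exact absurd hr (hx.2.1 _)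
  | cyclic _ _ h => exact absurd hx h
  | lonely _ => rfl

theorem IsLink.exists_detour (hl : IsLink G W l) (hv : v ∈ W) (hlv : G.Adj l v)
    (hxv : G.Adj x v) (hne : l ≠ x) : ∃ u, Detour G W x v l u := by
  obtain ⟨hlW, a, ha, b, hb, hab, hla, hlb⟩ := hl
  by_cases hav : a = v
  · subst hav
    exact ⟨b, ha, hb, hlW, hab.symm, hne, hxv, hlv.symm, hlb⟩
  · exact ⟨a, hv, ha, hlW, hav, hne, hxv, hlv.symm, hla⟩

/-- Every neighbor of `W` that is not free has an allowed color. -/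
theorem exists_allows (hd : ∀ x u, Reaches G W x u → Reaches G W x (d x))
    (hσ : ∀ v x y, IsLink G W x → G.Adj x v → IsLink G W y → G.Adj y v → y ≠ x →
      IsLink G W (σ v x) ∧ G.Adj (σ v x) v ∧ σ v x ≠ x)
    (hxW : x ∈ W ∨ ∃ w ∈ W, G.Adj x w) (hfree : ∀ v ∈ W, ¬ IsFree G W v x) :
    ∃ u, Allows G W d e σ x u := by
  by_cases hx : x ∈ W
  · exact ⟨x, .own hx⟩
  obtain ⟨w, hw, hxw⟩ := hxW.resolve_left hx
  by_cases hr : ∃ u, Reaches G W x u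
  · obtain ⟨u, hu⟩ := hr
    have hr := hd x u hu
    by_cases h : ∃ l v, IsLonely G W l ∧ v ∈ W ∧ G.Adj l v ∧ G.Adj x v ∧ d x = e l
    · obtain ⟨l, v, hl, hv, hlv, hxv, hde⟩ := h
      obtain ⟨b, hb⟩ := hl.1.exists_detour hv hlv hxv (by rintro rfl; exact hl.2.1 _ hr)
      exact ⟨b, .swap hx hr hl hde hb⟩
    · exact ⟨d x, .reach hx hr fun l v hl hv hlv hxv hde => h ⟨l, v, hl, hv, hlv, hxv, hde⟩⟩
  · have hr' : ∀ u, ¬ Reaches G W x u := fun u hu => hr ⟨u, hu⟩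
    have hlink : IsLink G W x := by
      by_contra hlink
      exact hfree w hw ⟨hx, hxw.symm, fun w' hw' hxw' => by_contra fun hne =>
        hlink ⟨hx, w', hw', w, hw, hne, hxw', hxw⟩, hr'⟩
    by_cases hl : IsLonely G W x
    · exact ⟨_, .lonely hl⟩
    · obtain ⟨v, hv, hxv, y, hy, hyv, hyx⟩ : ∃ v ∈ W, G.Adj x v ∧ ∃ y, IsLink G W y ∧
          G.Adj y v ∧ y ≠ x := by
        by_contra! h
        exact hl ⟨hlink, hr', h⟩
      obtain ⟨h1, h2, h3⟩ := hσ v x y hlink hxv hy hyv hyx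
      obtain ⟨u, hu⟩ := h1.exists_detour hv h2 hxv h3
      exact ⟨u, .cyclic hlink hr' hl hu⟩

/-- There is a cyclic order of the links around each vertex. -/
theorem exists_cyclic_order [Finite V] (G : SimpleGraph V) (W : Finset V) :
    ∃ σ : V → Equiv.Perm V, ∀ v x y, IsLink G W x → G.Adj x v → IsLink G W y → G.Adj y v →
      y ≠ x → IsLink G W (σ v x) ∧ G.Adj (σ v x) v ∧ σ v x ≠ x := by
  classical
  have := Fintype.ofFinite V
  have key : ∀ v, ∃ f : Equiv.Perm V, f.IsCycleOn {y | IsLink G W y ∧ G.Adj y v} := by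
    intro v
    obtain ⟨f, hf, -⟩ :=
      (Set.toFinite {y | IsLink G W y ∧ G.Adj y v}).toFinset.exists_cycleOn
    exact ⟨f, by simpa using hf⟩
  choose σ hσ using key
  refine ⟨σ, fun v x y hx hxv hy hyv hne => ?_⟩
  have hxs : x ∈ {y | IsLink G W y ∧ G.Adj y v} := ⟨hx, hxv⟩
  obtain ⟨h1, h2⟩ := (hσ v).apply_mem_iff.mpr hxs
  exact ⟨h1, h2, (hσ v).apply_ne ⟨x, hxs, y, ⟨hy, hyv⟩, hne.symm⟩ hxs⟩

/-- Counting the colors at `v ∈ W`: the colors missing among the neighbors of `v` that are not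
free are at most as many as the free neighbors. -/
theorem card_missing_le [Fintype V] [DecidableEq V] [DecidableRel G.Adj]
    [DecidablePred (IsFree G W v)] (hg : 9 ≤ G.egirth)
    (hdeg : W.card ≤ G.degree v + 1)
    (he : ∀ x ∉ W, e x ∈ W ∧ ¬ G.Adj x (e x))
    (he' : ∀ x ∉ W, G.Adj v (e x) → G.Adj x v → W.card ≤ G.degree v) (hv : v ∈ W) {c : V → V}
    (hc : ∀ x, G.Adj v x → ¬ IsFree G W v x → Allows G W d e σ x (c x)) :
    (W.erase v \ ((G.neighborFinset v).filter fun x => ¬ IsFree G W v x).image c).card ≤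
      ((G.neighborFinset v).filter fun x => IsFree G W v x).card := by
  set N := (G.neighborFinset v).filter fun x => ¬ IsFree G W v x with hN
  have hsplit := card_filter_add_card_filter_not (s := G.neighborFinset v)
    (fun x => IsFree G W v x)
  rw [card_neighborFinset_eq_degree, ← hN] at hsplit
  have hNmem : ∀ x ∈ N, G.Adj v x ∧ Allows G W d e σ x (c x) := by
    intro x hx
    rw [hN, mem_filter, mem_neighborFinset] at hx
    exact ⟨hx.1, hc x hx.1 hx.2⟩
  have hsub : N.image c ⊆ W.erase v := by
    intro u hu
    obtain ⟨x, hx, rfl⟩ := mem_image.mp hu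
    obtain ⟨hvx, hadm⟩ := hNmem x hx
    obtain ⟨h1, h2⟩ := hadm.mem_and_not_adj hg he
    refine mem_erase.mpr ⟨fun h => ?_, h1⟩
    by_cases hxW : x ∈ W
    · exact hvx.ne (h.symm.trans (hadm.eq_of_mem hxW))
    · exact h2 hxW (h ▸ hvx.symm)
  have hinj : ∀ S ⊆ N, (∀ x ∈ S, IsLonely G W x → ¬ G.Adj v (e x)) → S.card ≤ (N.image c).card := by
    intro S hSN hS
    have hmix : ∀ x ∈ S, ∀ y ∈ S, x ∈ W → y ∉ W → c x ≠ c y := by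
      intro x hx y hy hxW hyW h
      obtain ⟨hvx, hax⟩ := hNmem x (hSN hx)
      obtain ⟨hvy, hay⟩ := hNmem y (hSN hy)
      have hcy : c y = x := h.symm.trans (hax.eq_of_mem hxW)
      by_cases hl : IsLonely G W y
      · exact hS y hy hl (hay.eq_of_lonely hl ▸ hcy ▸ hvx)
      · exact hay.not_adj_of_not_isLonely hg hv hyW hvy hl (hcy ▸ hvx)
    rw [← card_image_of_injOn (s := S) (f := c)]
    · exact card_le_card (image_subset_image hSN)
    · intro x hx y hy h
      obtain ⟨hvx, hax⟩ := hNmem x (hSN hx)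
      obtain ⟨hvy, hay⟩ := hNmem y (hSN hy)
      by_cases hxW : x ∈ W <;> by_cases hyW : y ∈ W
      · exact (hax.eq_of_mem hxW).symm.trans (h.trans (hay.eq_of_mem hyW))
      · exact absurd h (hmix x hx y hy hxW hyW)
      · exact absurd h.symm (hmix y hy x hx hyW hxW)
      · exact hax.eq_of_common_neighbor hg he hv hxW hyW hvx hvy (h ▸ hay)
  have hcard : W.card ≤ (N.image c).card +
      ((G.neighborFinset v).filter fun x => IsFree G W v x).card + 1 := by
    by_cases h : ∃ l, IsLonely G W l ∧ G.Adj l v ∧ G.Adj v (e l)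
    · obtain ⟨l, hl, hlv, hvl⟩ := h
      have h1 := he' l hl.1.1 hvl hlv
      have h2 := hinj (N.erase l) (erase_subset l N) fun x hx hlx _ =>
        (mem_erase.mp hx).1 (hl.2.2 v hv hlv x hlx.1 (hNmem x (mem_erase.mp hx).2).1.symm)
      have h3 := pred_card_le_card_erase (s := N) (a := l)
      omega
    · have := hinj N Subset.rfl fun x hx hlx hvx => h ⟨x, hlx, (hNmem x hx).1.symm, hvx⟩
      omega
  rw [card_sdiff_of_subset hsub, card_erase_of_mem hv]
  omega

/-- `W` and its neighbors can be properly colored by `W` so that every vertex of `W` sees all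
other colors. -/
theorem exists_partial_coloring [Fintype V] [DecidableRel G.Adj] (hg : 9 ≤ G.egirth)
    (hdeg : ∀ v ∈ W, W.card ≤ G.degree v + 1)
    (henc : ∀ x ∉ W, ∃ u ∈ W, ¬ G.Adj x u ∧
      ∀ w ∈ W, G.Adj w u → G.Adj x w → W.card ≤ G.degree w) :
    ∃ c : V → V, (∀ x, (x ∈ W ∨ ∃ w ∈ W, G.Adj x w) → c x ∈ W) ∧
      (∀ x y, (x ∈ W ∨ ∃ w ∈ W, G.Adj x w) → (y ∈ W ∨ ∃ w ∈ W, G.Adj y w) →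
        G.Adj x y → c x ≠ c y) ∧
      (∀ v ∈ W, c v = v) ∧ ∀ v ∈ W, ∀ u ∈ W, u ≠ v → ∃ y, G.Adj v y ∧ c y = u := by
  classical
  obtain ⟨σ, hσ⟩ := exists_cyclic_order G W
  have hd : ∀ x, ∃ u, ∀ u', Reaches G W x u' → Reaches G W x u := by
    intro x
    by_cases h : ∃ u, Reaches G W x u
    · exact h.imp fun u hu _ _ => hu
    · exact ⟨x, fun u hu => absurd ⟨u, hu⟩ h⟩
  choose d hd using hd
  have he : ∀ x, ∃ u, x ∉ W → u ∈ W ∧ ¬ G.Adj x u ∧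
      ∀ w ∈ W, G.Adj w u → G.Adj x w → W.card ≤ G.degree w := by
    intro x
    by_cases hx : x ∈ W
    · exact ⟨x, fun h => absurd hx h⟩
    · exact (henc x hx).imp fun u hu _ => hu
  choose e he using he
  have he₁ : ∀ x ∉ W, e x ∈ W ∧ ¬ G.Adj x (e x) := fun x hx => ⟨(he x hx).1, (he x hx).2.1⟩
  have hc : ∀ x, ∃ u, (x ∈ W ∨ ∃ w ∈ W, G.Adj x w) → (∀ v ∈ W, ¬ IsFree G W v x) →
      Allows G W d e σ x u := by
    intro x
    by_cases hx : (x ∈ W ∨ ∃ w ∈ W, G.Adj x w) ∧ ∀ v ∈ W, ¬ IsFree G W v x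
    · exact (exists_allows hd hσ hx.1 hx.2).imp fun u hu _ _ => hu
    · exact ⟨x, fun h1 h2 => absurd ⟨h1, h2⟩ hx⟩
  choose c₀ hc₀ using hc
  have hnotFree : ∀ v ∈ W, ∀ x, G.Adj v x → ¬ IsFree G W v x → ∀ w ∈ W, ¬ IsFree G W w x := by
    intro v hv x hvx h w _ hw
    exact h (hw.2.2.1 v hv hvx.symm ▸ hw)
  have hfill : ∀ v, ∃ g : V → V, v ∈ W → (∀ y, IsFree G W v y → g y ∈ W ∧ g y ≠ v) ∧
      ∀ u ∈ W, u ≠ v → (∃ y, IsFree G W v y ∧ g y = u) ∨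
        ∃ y, G.Adj v y ∧ (∀ w ∈ W, ¬ IsFree G W w y) ∧ c₀ y = u := by
    intro v
    by_cases hv : v ∈ W
    swap
    · exact ⟨id, fun h => absurd h hv⟩
    have : Nonempty V := ⟨v⟩
    obtain ⟨g, hg1, hg2⟩ := exists_mapsTo_covering
      ((G.neighborFinset v).filter fun x => IsFree G W v x)
      (W.erase v \ ((G.neighborFinset v).filter fun x => ¬ IsFree G W v x).image c₀)
      (W.erase v) sdiff_subset
      (card_missing_le hg (hdeg v hv) he₁ (fun x hx h1 h2 => (he x hx).2.2 v hv h1 h2) hv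
        (fun x hx hfx => hc₀ x (.inr ⟨v, hv, hx.symm⟩) (hnotFree v hv x hx hfx)))
      (by
        rintro ⟨y, hy⟩
        rw [mem_filter] at hy
        obtain ⟨u, hu, hyu, -⟩ := henc y hy.2.1
        exact ⟨u, mem_erase.mpr ⟨by rintro rfl; exact hyu hy.2.2.1.symm, hu⟩⟩)
    refine ⟨g, fun _ => ⟨fun y hy => ?_, fun u hu huv => ?_⟩⟩
    · have := hg1 y (by simpa using ⟨hy.2.1, hy⟩)
      rw [mem_erase] at this
      exact this.symm
    · by_cases h : u ∈ ((G.neighborFinset v).filter fun x => ¬ IsFree G W v x).image c₀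
      · obtain ⟨y, hy, rfl⟩ := mem_image.mp h
        rw [mem_filter, mem_neighborFinset] at hy
        exact .inr ⟨y, hy.1, hnotFree v hv y hy.1 hy.2, rfl⟩
      · obtain ⟨y, hy, hyu⟩ := hg2 u (mem_sdiff.mpr ⟨mem_erase.mpr ⟨huv, hu⟩, h⟩)
        exact .inl ⟨y, (mem_filter.mp hy).2, hyu⟩
  choose g hg' using hfill
  obtain ⟨c, hcfree, hcnot⟩ : ∃ c : V → V,
      (∀ v ∈ W, ∀ x, IsFree G W v x → c x = g v x) ∧
      ∀ x, (∀ v ∈ W, ¬ IsFree G W v x) → c x = c₀ x := by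
    refine ⟨fun x => if h : ∃ v ∈ W, IsFree G W v x then g h.choose x else c₀ x, ?_, ?_⟩
    · intro v hv x hx
      have h : ∃ v ∈ W, IsFree G W v x := ⟨v, hv, hx⟩
      have : h.choose = v := hx.2.2.1 _ h.choose_spec.1 h.choose_spec.2.2.1.symm
      simp only [dif_pos h, this]
    · intro x hx
      exact dif_neg fun ⟨v, hv, h⟩ => hx v hv h
  have hadm : ∀ x, (x ∈ W ∨ ∃ w ∈ W, G.Adj x w) → (∀ v ∈ W, ¬ IsFree G W v x) →
      Allows G W d e σ x (c x) := fun x hx h => hcnot x h ▸ hc₀ x hx h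
  have hcolor : ∀ x, (x ∈ W ∨ ∃ w ∈ W, G.Adj x w) →
      c x ∈ W ∧ (x ∉ W → ¬ G.Adj x (c x)) := by
    intro x hx
    by_cases hfree : ∀ v ∈ W, ¬ IsFree G W v x
    · exact (hadm x hx hfree).mem_and_not_adj hg he₁
    · push Not at hfree
      obtain ⟨v, hv, hfx⟩ := hfree
      obtain ⟨h1, h2⟩ := (hg' v hv).1 x hfx
      rw [hcfree v hv x hfx]
      exact ⟨h1, fun _ h => h2 (hfx.2.2.1 _ h1 h)⟩
  have hown : ∀ v ∈ W, c v = v := fun v hv =>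
    (hadm v (.inl hv) fun w _ h => h.1 hv).eq_of_mem hv
  refine ⟨c, fun x hx => (hcolor x hx).1, ?_, hown, ?_⟩
  · intro x y hx hy hxy h
    by_cases hxW : x ∈ W <;> by_cases hyW : y ∈ W
    · rw [hown x hxW, hown y hyW] at h
      exact hxy.ne h
    · rw [hown x hxW] at h
      exact (hcolor y hy).2 hyW (h ▸ hxy.symm)
    · rw [hown y hyW] at h
      exact (hcolor x hx).2 hxW (h ▸ hxy)
    · have hx' := hx.resolve_left hxW
      have hy' := hy.resolve_left hyW
      obtain ⟨w, hw, hxw⟩ := hx'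
      obtain ⟨w', hw', hyw'⟩ := hy'
      exact (hadm x hx fun v _ hf => hf.2.2.2 w' ⟨hw', y, hyW, hxy, hyw'⟩).false_of_adj hg hxW hyW
        hxy ⟨w, hw, hxw⟩ ⟨w', hw', hyw'⟩
        (h ▸ hadm y hy fun v _ hf => hf.2.2.2 w ⟨hw, x, hxW, hxy.symm, hxw⟩)
  · intro v hv u hu huv
    rcases (hg' v hv).2 u hu huv with ⟨y, hy, rfl⟩ | ⟨y, hvy, hy, rfl⟩
    · exact ⟨y, hy.2.1, hcfree v hv y hy⟩
    · exact ⟨y, hvy, hcnot y hy⟩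

end

end GoodSet

section

variable {V : Type*} [Fintype V] {G : SimpleGraph V}

theorem IsBColoring.le_card_filter_degree [DecidableRel G.Adj] {k : ℕ} {C : V → Fin k}
    (h : IsBColoring G k C) : k ≤ (univ.filter fun v => k - 1 ≤ G.degree v).card := by
  classical
  choose b hb hbv using h.2
  have hinj : Function.Injective b := fun i j hij => by rw [← hb i, ← hb j, hij]
  have hsub : univ.image b ⊆ univ.filter fun v => k - 1 ≤ G.degree v := by
    intro v hv
    obtain ⟨i, -, rfl⟩ := mem_image.mp hv
    refine mem_filter.mpr ⟨mem_univ _, ?_⟩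
    have : univ.erase i ⊆ (G.neighborFinset (b i)).image C := by
      intro j hj
      obtain ⟨w, hw, hwj⟩ := hbv i j (by rw [hb i]; exact (mem_erase.mp hj).1)
      exact mem_image.mpr ⟨w, by simpa using hw, hwj⟩
    have := (card_le_card this).trans card_image_le
    simpa using this
  simpa [card_image_of_injective _ hinj] using card_le_card hsub

theorem IsBColoring.le_mParam [DecidableRel G.Adj] {k : ℕ} {C : V → Fin k}
    (h : IsBColoring G k C) : k ≤ mParam G :=
  le_csSup ⟨Fintype.card V, fun _ hk => le_trans hk (card_le_univ _)⟩ h.le_card_filter_degree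

/-- A good set of a graph of girth at least 9 consists of the b-vertices of a b-coloring. -/
theorem IsGoodSet.exists_isBColoring [DecidableRel G.Adj] (hg : 9 ≤ G.egirth) {W : Finset V}
    (hW : IsGoodSet G W) : ∃ C : V → Fin (mParam G), IsBColoring G (mParam G) C := by
  obtain ⟨hcard, hdeg, henc, hout⟩ := hW
  obtain ⟨c, hcW, hproper, hown, hsee⟩ := GoodSet.exists_partial_coloring (W := W) hg
    (fun v hv => by have := hdeg v hv; omega) (by
      intro x hx
      have := henc x hx
      unfold Encircles at this
      push Not at this
      obtain ⟨u, hu, hxu, h⟩ := this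
      refine ⟨u, hu, hxu, fun w hw hwu hxw => ?_⟩
      have h1 := h w hw hwu.symm hxw
      have h2 := hdeg w hw
      omega)
  obtain ⟨c', h1, h2, h3⟩ := exists_proper_extension W {x | x ∈ W ∨ ∃ w ∈ W, G.Adj x w} c hcW
    (fun x hx y hy => hproper x y hx hy) (by
      intro x hx
      rw [Set.mem_ofPred_eq, not_or] at hx
      rw [hcard]
      by_contra! h
      exact hx.2 (hout x hx.1 h))
  let φ : W ≃ Fin (mParam G) := W.equivFinOfCardEq hcard
  refine ⟨fun x => φ ⟨c' x, h1 x⟩, fun u v huv h => ?_, fun i => ?_⟩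
  · exact h2 u v huv (congrArg Subtype.val (φ.injective h))
  · obtain ⟨⟨v, hv⟩, rfl⟩ := φ.surjective i
    have hcv : c' v = v := (h3 v (.inl hv)).trans (hown v hv)
    refine ⟨v, by simp only [hcv], fun j hj => ?_⟩
    obtain ⟨⟨u, hu⟩, rfl⟩ := φ.surjective j
    obtain ⟨y, hvy, hyu⟩ := hsee v hv u hu (by rintro rfl; exact hj (by simp only [hcv]))
    refine ⟨y, hvy, ?_⟩
    have : c' y = u := (h3 y (.inr ⟨v, hv, hvy.symm⟩)).trans hyu
    simp only [this]

end

/-- If `G` has girth at least 9 and has a good set, then `χ_b(G) = m(G)`. -/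
theorem bChromatic_eq_mParam_of_goodSet {V : Type*} [Fintype V] (G : SimpleGraph V)
    [DecidableRel G.Adj] (hg : 9 ≤ G.egirth) (hW : ∃ W : Finset V, IsGoodSet G W) :
    bChromatic G = mParam G := by
  obtain ⟨W, hW⟩ := hW
  obtain ⟨C, hC⟩ := hW.exists_isBColoring hg
  refine le_antisymm (csSup_le ⟨_, C, hC⟩ ?_) (le_csSup ⟨mParam G, ?_⟩ ⟨C, hC⟩)
  · rintro k ⟨C', hC'⟩
    exact hC'.le_mParam
  · rintro k ⟨C', hC'⟩
    exact hC'.le_mParam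
end

section
/- Let G be a finite simple graph and let W be a subset of M(G) with exactly m(G) vertices. If W encircles some vertex v ∈ V(G)\W, then W is not a basis of any b-coloring of G with m(G) colors; that is, there is no b-coloring of G with m(G) colors in which the vertices of W are b-vertices of pairwise distinct colors, one for each color class. -/
open SimpleGraph Finset

/-- A b-vertex of minimum possible degree sees no color twice in its neighborhood. -/
theorem IsBVertex.injOn_neighborFinset {V : Type*} [Fintype V] {G : SimpleGraph V}
    [DecidableRel G.Adj] {k : ℕ} {C : V → Fin k} {u : V} (hu : IsBVertex G C u)
    (hdeg : G.degree u = k - 1) : Set.InjOn C (G.neighborFinset u : Set V) := by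
  rw [← Finset.card_image_iff]
  refine le_antisymm Finset.card_image_le ?_
  have hsub : Finset.univ.erase (C u) ⊆ (G.neighborFinset u).image C := by
    intro j hj
    obtain ⟨w, hw, hwj⟩ := hu j (Finset.ne_of_mem_erase hj)
    exact Finset.mem_image.2 ⟨w, (G.mem_neighborFinset u w).2 hw, hwj⟩
  have hcard := Finset.card_le_card hsub
  rwa [Finset.card_erase_of_mem (Finset.mem_univ _), Finset.card_univ, Fintype.card_fin,
    ← hdeg, ← G.card_neighborFinset_eq_degree u] at hcard

/-- If `W ⊆ M(G)` has `m(G)` vertices and encircles some vertex `v ∉ W`, then `W` is not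
a basis of a b-coloring of `G` with `m(G)` colors. -/
theorem not_basis_of_encircles {V : Type*} [Fintype V] (G : SimpleGraph V)
    [DecidableRel G.Adj] (W : Finset V)
    (hWM : ∀ v ∈ W, mParam G - 1 ≤ G.degree v) (hWcard : W.card = mParam G)
    (v : V) (hv : v ∉ W) (henc : Encircles G W v) :
    ¬ ∃ C : V → Fin (mParam G), IsBColoring G (mParam G) C ∧
        Set.InjOn C (W : Set V) ∧ ∀ w ∈ W, IsBVertex G C w := by
  rintro ⟨C, ⟨hproper, -⟩, hinj, hb⟩
  have himage : W.image C = Finset.univ := by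
    rw [← Finset.card_eq_iff_eq_univ, Finset.card_image_of_injOn hinj, hWcard, Fintype.card_fin]
  obtain ⟨x, hxW, hx⟩ := Finset.mem_image.1 (himage ▸ Finset.mem_univ (C v))
  rcases henc x hxW with hadj | ⟨w, hwW, hxw, hvw, hdeg⟩
  · exact hproper v x hadj hx.symm
  · have hxv : x = v := (hb w hwW).injOn_neighborFinset hdeg
      (by simpa using hxw.symm) (by simpa using hvw.symm) hx
    exact hv (hxv ▸ hxW)
end

section
/- Let G be a finite simple graph with girth at least 8. Then G does not have a good set if and only if |M(G)| = m(G) and M(G) encircles some vertex in V(G)\M(G). -/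
open SimpleGraph Finset

section Girth

variable {V : Type*} {G : SimpleGraph V}

lemma not_isCycle_of_length_lt_egirth (hg : 8 ≤ G.egirth) {v : V} (p : G.Walk v v)
    (hp : p.length < 8) : ¬ p.IsCycle := fun h => by
  have h8 : ((8 : ℕ) : ℕ∞) ≤ p.length := le_egirth.1 hg v p h
  exact absurd (ENat.natCast_le_natCast.1 h8) (by omega)

lemma no_closed_walk_three (hg : 8 ≤ G.egirth) {a b c : V} (hab : G.Adj a b) (hbc : G.Adj b c)
    (hca : G.Adj c a) : False := by
  refine not_isCycle_of_length_lt_egirth hg (.cons hab (.cons hbc (.cons hca .nil))) (by simp) ?_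
  have := hab.ne; have := hbc.ne; have := hca.ne
  simp [Walk.cons_isCycle_iff]
  grind

lemma no_cycle_four (hg : 8 ≤ G.egirth) {a b c d : V} (hab : G.Adj a b) (hbc : G.Adj b c)
    (hcd : G.Adj c d) (hda : G.Adj d a) (hac : a ≠ c) (hbd : b ≠ d) : False := by
  refine not_isCycle_of_length_lt_egirth hg
    (.cons hab (.cons hbc (.cons hcd (.cons hda .nil)))) (by simp) ?_
  have := hab.ne; have := hbc.ne; have := hcd.ne; have := hda.ne
  simp [Walk.cons_isCycle_iff]
  grind

lemma no_closed_walk_five (hg : 8 ≤ G.egirth) {a b c d e : V} (hab : G.Adj a b) (hbc : G.Adj b c)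
    (hcd : G.Adj c d) (hde : G.Adj d e) (hea : G.Adj e a) : False := by
  have h3 := @no_closed_walk_three V G hg
  have := hab.ne; have := hbc.ne; have := hcd.ne; have := hde.ne; have := hea.ne
  have hac : a ≠ c := by rintro rfl; exact h3 hcd hde hea
  have hbd : b ≠ d := by rintro rfl; exact h3 hde hea hab
  have hce : c ≠ e := by rintro rfl; exact h3 hea hab hbc
  have hda : d ≠ a := by rintro rfl; exact h3 hab hbc hcd
  have heb : e ≠ b := by rintro rfl; exact h3 hbc hcd hde
  refine not_isCycle_of_length_lt_egirth hg
    (.cons hab (.cons hbc (.cons hcd (.cons hde (.cons hea .nil))))) (by simp) ?_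
  simp [Walk.cons_isCycle_iff]
  grind

lemma no_closed_walk_seven (hg : 8 ≤ G.egirth) {a b c d e f g : V} (hab : G.Adj a b)
    (hbc : G.Adj b c) (hcd : G.Adj c d) (hde : G.Adj d e) (hef : G.Adj e f) (hfg : G.Adj f g)
    (hga : G.Adj g a) : False := by
  have h3 := @no_closed_walk_three V G hg
  have h5 := @no_closed_walk_five V G hg
  have := hab.ne; have := hbc.ne; have := hcd.ne; have := hde.ne; have := hef.ne
  have := hfg.ne; have := hga.ne
  have hac : a ≠ c := by rintro rfl; exact h5 hcd hde hef hfg hga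
  have hbd : b ≠ d := by rintro rfl; exact h5 hde hef hfg hga hab
  have hce : c ≠ e := by rintro rfl; exact h5 hef hfg hga hab hbc
  have hdf : d ≠ f := by rintro rfl; exact h5 hfg hga hab hbc hcd
  have heg : e ≠ g := by rintro rfl; exact h5 hga hab hbc hcd hde
  have hfa : f ≠ a := by rintro rfl; exact h5 hab hbc hcd hde hef
  have hgb : g ≠ b := by rintro rfl; exact h5 hbc hcd hde hef hfg
  have had : a ≠ d := by rintro rfl; exact h3 hab hbc hcd
  have hbe : b ≠ e := by rintro rfl; exact h3 hbc hcd hde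
  have hcf : c ≠ f := by rintro rfl; exact h3 hcd hde hef
  have hdg : d ≠ g := by rintro rfl; exact h3 hde hef hfg
  have hea : e ≠ a := by rintro rfl; exact h3 hef hfg hga
  have hfb : f ≠ b := by rintro rfl; exact h3 hfg hga hab
  have hgc : g ≠ c := by rintro rfl; exact h3 hga hab hbc
  refine not_isCycle_of_length_lt_egirth hg (.cons hab (.cons hbc (.cons hcd (.cons hde
    (.cons hef (.cons hfg (.cons hga .nil))))))) (by simp) ?_
  simp [Walk.cons_isCycle_iff]
  grind

/-- A path of length three is the only walk of length three between its ends. -/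
lemma eq_and_eq_of_walks_three (hg : 8 ≤ G.egirth) {a b c d b' c' : V} (hab : G.Adj a b)
    (hbc : G.Adj b c) (hcd : G.Adj c d) (hac : a ≠ c) (hbd : b ≠ d) (hab' : G.Adj a b')
    (hbc' : G.Adj b' c') (hcd' : G.Adj c' d) : b' = b ∧ c' = c := by
  have h4 := @no_cycle_four V G hg
  have := hab.ne; have := hbc.ne; have := hcd.ne
  have := hab'.ne; have := hbc'.ne; have := hcd'.ne
  by_contra hne
  have hnad : ¬ G.Adj a d := fun h => h4 hab hbc hcd h.symm hac hbd
  have hbb : b' ≠ b := by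
    rintro rfl; exact h4 hbc hcd hcd'.symm hbc'.symm hbd (fun h => hne ⟨rfl, h.symm⟩)
  have hcc : c' ≠ c := by
    rintro rfl; exact h4 hab hbc hbc'.symm hab'.symm hac hbb.symm
  have h1 : c' ≠ a := by rintro rfl; exact hnad hcd'
  have h2 : b' ≠ d := by rintro rfl; exact hnad hab'
  have h3 : c' ≠ b := by
    rintro rfl; exact no_closed_walk_three hg hab hbc'.symm hab'.symm
  have h5 : b' ≠ c := by
    rintro rfl; exact no_closed_walk_three hg hab hbc hab'.symm
  have h6 : a ≠ d := by rintro rfl; exact no_closed_walk_three hg hab hbc hcd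
  refine not_isCycle_of_length_lt_egirth hg (.cons hab (.cons hbc (.cons hcd (.cons hcd'.symm
    (.cons hbc'.symm (.cons hab'.symm .nil)))))) (by simp) ?_
  simp [Walk.cons_isCycle_iff]
  grind

end Girth

section MParam

variable {V : Type*} [Fintype V] (G : SimpleGraph V) [DecidableRel G.Adj]

lemma bddAbove_mParam_set :
    BddAbove {k : ℕ | k ≤ (univ.filter fun v => k - 1 ≤ G.degree v).card} :=
  ⟨Fintype.card V, fun _ hk => hk.trans (card_le_univ _)⟩

lemma mParam_le_card_denseSet : mParam G ≤ (denseSet G).card :=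
  Nat.sSup_mem (s := {k : ℕ | k ≤ (univ.filter fun v => k - 1 ≤ G.degree v).card})
    ⟨0, Nat.zero_le _⟩ (bddAbove_mParam_set G)

lemma card_filter_mParam_le_degree : #{v | mParam G ≤ G.degree v} ≤ mParam G := by
  by_contra! h
  have : mParam G + 1 ≤ mParam G := le_csSup (bddAbove_mParam_set G) h
  omega

lemma mParam_pos [Nonempty V] : 0 < mParam G := by
  refine le_csSup (bddAbove_mParam_set G) ?_
  simp [Fintype.card_pos, Nat.succ_le_iff]

variable {G}

@[simp]
lemma mem_denseSet {v : V} : v ∈ denseSet G ↔ mParam G - 1 ≤ G.degree v := by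
  simp [denseSet]

/-- Structure of an encircling set that contains all vertices of degree at least `m(G)`:
some vertex `w ∈ W` next to `u` of degree `m(G) - 1` has a neighbor in `W`, and `u` has
another neighbor in `W`. -/
lemma Encircles.exists_parent {W : Finset V} {u : V} (hW : Encircles G W u)
    (hu : u ∉ W) (hcard : W.card = mParam G)
    (hdeg : ∀ x, mParam G ≤ G.degree x → x ∈ W) :
    ∃ w ∈ W, ∃ c ∈ W, ∃ w' ∈ W, w' ≠ w ∧ G.Adj u w ∧ G.Adj w c ∧ G.Adj u w' ∧
      G.degree w = mParam G - 1 := by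
  classical
  have : Nonempty V := ⟨u⟩
  have hpos := mParam_pos G
  have hfar : ∃ c ∈ W, ¬ G.Adj u c := by
    by_contra! h
    refine hu (hdeg u ?_)
    rw [← hcard, ← card_neighborFinset_eq_degree]
    exact card_le_card fun v hv => by simpa using h v hv
  obtain ⟨c, hc, huc⟩ := hfar
  obtain ⟨w, hw, hcw, huw, hdw⟩ := (hW c hc).resolve_left huc
  have hother : ∃ v ∈ W, v ≠ w ∧ ¬ G.Adj w v := by
    by_contra! h
    have hsub : W ⊆ insert w ((G.neighborFinset w).erase u) := fun v hv => by
      rw [mem_insert, mem_erase, mem_neighborFinset]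
      exact or_iff_not_imp_left.2 fun hvw => ⟨fun e => hu (e ▸ hv), h v hv hvw⟩
    have h1 := (card_le_card hsub).trans (card_insert_le _ _)
    rw [card_erase_of_mem (by simpa using huw.symm), card_neighborFinset_eq_degree] at h1
    have : 0 < G.degree w := (G.degree_pos_iff_exists_adj w).2 ⟨u, huw.symm⟩
    omega
  obtain ⟨v, hv, hvw, hwv⟩ := hother
  rcases hW v hv with huv | ⟨w', hw', hvw', huw', -⟩
  · exact ⟨w, hw, c, hc, v, hv, hvw, huw, hcw.symm, huv, hdw⟩
  · refine ⟨w, hw, c, hc, w', hw', ?_, huw, hcw.symm, huw', hdw⟩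
    rintro rfl
    exact hwv hvw'.symm

/-- If `c - w - u - w'` is a path with `c, w' ∈ W` and `w ∉ W`, then only `w` can be encircled
by `W`, and this requires `u ∈ W`. -/
lemma Encircles.eq_of_path (hg : 8 ≤ G.egirth) {W : Finset V} {c w u w' z : V}
    (hcw : G.Adj c w) (hwu : G.Adj w u) (huw' : G.Adj u w') (hcu : c ≠ u)
    (hww' : w ≠ w') (hc : c ∈ W) (hw' : w' ∈ W) (hw : w ∉ W) (hz : Encircles G W z) :
    z = w ∧ u ∈ W := by
  rcases hz c hc with h1 | ⟨a, ha, hca, hza, -⟩ <;>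
  rcases hz w' hw' with h2 | ⟨b, hb, hwb, hzb, -⟩
  · exact (no_closed_walk_five hg hcw hwu huw' h2.symm h1).elim
  · obtain ⟨rfl, rfl⟩ := eq_and_eq_of_walks_three hg hcw hwu huw' hcu hww' h1.symm hzb hwb.symm
    exact ⟨rfl, hb⟩
  · obtain ⟨rfl, rfl⟩ := eq_and_eq_of_walks_three hg hcw hwu huw' hcu hww' hca hza.symm h2
    exact (hw ha).elim
  · exact (no_closed_walk_seven hg hcw hwu huw' hwb hzb.symm hza hca.symm).elim

/-- If `c - w - u - w'` is a path with `c, w, w' ∈ W` and `u ∉ W`, then exchanging `w` for a dense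
vertex `x` outside `W` gives a good set, unless `x = u` and the exchanged set encircles `w`. -/
lemma isGoodSet_exchange_parent [DecidableEq V] (hg : 8 ≤ G.egirth) {W : Finset V}
    {c w u w' x : V} (hu : u ∉ W) (hcard : W.card = mParam G)
    (hdense : ∀ v ∈ W, mParam G - 1 ≤ G.degree v) (hdeg : ∀ x, mParam G ≤ G.degree x → x ∈ W)
    (hw : w ∈ W) (hc : c ∈ W) (hw' : w' ∈ W) (hne : w' ≠ w) (huw : G.Adj u w) (hwc : G.Adj w c)
    (huw' : G.Adj u w') (hdw : G.degree w = mParam G - 1) (hx : mParam G - 1 ≤ G.degree x)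
    (hxW : x ∉ W) (hxu : x = u → ¬ Encircles G (insert x (W.erase w)) w) :
    IsGoodSet G (insert x (W.erase w)) := by
  have : Nonempty V := ⟨u⟩
  have hpos := mParam_pos G
  have hwx : w ≠ x := fun h => hxW (h ▸ hw)
  have hcu : c ≠ u := fun h => hu (h ▸ hc)
  refine ⟨?_, ?_, ?_, ?_⟩
  · rw [card_insert_of_notMem (fun h => hxW (mem_of_mem_erase h)), card_erase_of_mem hw]
    omega
  · intro v hv
    rcases mem_insert.1 hv with rfl | hv
    · exact hx
    · exact hdense v (mem_of_mem_erase hv)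
  · intro z _ hz
    obtain ⟨rfl, hmem⟩ := hz.eq_of_path hg hwc.symm huw.symm huw' hcu hne.symm
      (mem_insert_of_mem (mem_erase.2 ⟨hwc.ne', hc⟩)) (mem_insert_of_mem (mem_erase.2 ⟨hne, hw'⟩))
      (by simp [hwx])
    rcases mem_insert.1 hmem with h | h
    · exact hxu h.symm hz
    · exact hu (mem_of_mem_erase h)
  · intro y hy hdy
    have : y ≠ w := by rintro rfl; omega
    exact (hy (mem_insert_of_mem (mem_erase.2 ⟨this, hdeg y hdy⟩))).elim

/-- If `u` is a dense vertex outside `W` and all vertices of `W` not adjacent to `u` are neighbors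
of one neighbor `w` of `u`, then exchanging such a vertex `c` for `u` gives a good set. -/
lemma isGoodSet_exchange_child [DecidableEq V] (hg : 8 ≤ G.egirth) {W : Finset V}
    {c w u w' : V} (hu : u ∉ W) (hcard : W.card = mParam G)
    (hdense : ∀ v ∈ W, mParam G - 1 ≤ G.degree v) (hdeg : ∀ x, mParam G ≤ G.degree x → x ∈ W)
    (hw : w ∈ W) (hc : c ∈ W) (hw' : w' ∈ W) (hne : w' ≠ w) (huw : G.Adj u w) (hwc : G.Adj w c)
    (huw' : G.Adj u w') (hdu : mParam G - 1 ≤ G.degree u)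
    (hall : ∀ v ∈ W, G.Adj u v ∨ G.Adj w v) :
    IsGoodSet G (insert u (W.erase c)) := by
  have : Nonempty V := ⟨u⟩
  have hpos := mParam_pos G
  have huc : ¬ G.Adj u c := fun h => no_closed_walk_three hg huw hwc h.symm
  have hcw' : w' ≠ c := by rintro rfl; exact huc huw'
  have hwmem : w ∈ insert u (W.erase c) := mem_insert_of_mem (mem_erase.2 ⟨hwc.ne, hw⟩)
  have hwmem' : w' ∈ insert u (W.erase c) := mem_insert_of_mem (mem_erase.2 ⟨hcw', hw'⟩)
  refine ⟨?_, ?_, ?_, ?_⟩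
  · rw [card_insert_of_notMem (fun h => hu (mem_of_mem_erase h)), card_erase_of_mem hc]
    omega
  · intro v hv
    rcases mem_insert.1 hv with rfl | hv
    · exact hdu
    · exact hdense v (mem_of_mem_erase hv)
  · intro z hzW hz
    have hzu : z ≠ u := by rintro rfl; exact hzW (mem_insert_self _ _)
    have hzw : z ≠ w := by rintro rfl; exact hzW hwmem
    have hzw' : z ≠ w' := by rintro rfl; exact hzW hwmem'
    have hadj : G.Adj z u := by
      rcases hz w hwmem with h1 | ⟨a, ha, hwa, hza, -⟩ <;>
      rcases hz w' hwmem' with h2 | ⟨b, hb, hwb, hzb, -⟩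
      · exact (no_cycle_four hg h1 huw.symm huw' h2.symm hzu hne.symm).elim
      · exact (no_closed_walk_five hg h1 huw.symm huw' hwb hzb.symm).elim
      · exact (no_closed_walk_five hg h2 huw'.symm huw hwa hza.symm).elim
      · by_contra hzu'
        have hau : a ≠ u := by rintro rfl; exact hzu' hza
        exact hne (eq_and_eq_of_walks_three hg hza hwa.symm huw.symm hzw hau hzb hwb.symm
          huw'.symm).2
    by_cases hc2 : ∃ v ∈ W, v ≠ c ∧ ¬ G.Adj u v
    · obtain ⟨v, hv, hvc, huv⟩ := hc2
      have hwv := (hall v hv).resolve_left huv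
      have hvu : v ≠ u := fun h => hu (h ▸ hv)
      rcases hz v (mem_insert_of_mem (mem_erase.2 ⟨hvc, hv⟩)) with h | ⟨a, -, hva, hza, -⟩
      · exact no_cycle_four hg h hwv.symm huw.symm hadj.symm hzw hvu
      · exact no_closed_walk_five hg hva hza.symm hadj huw hwv
    · push Not at hc2
      have hsub : W.erase c ⊆ G.neighborFinset u := fun v hv => by
        simpa using hc2 v (mem_of_mem_erase hv) (ne_of_mem_erase hv)
      have hle : (G.neighborFinset u).card ≤ (W.erase c).card := by
        rw [card_erase_of_mem hc, hcard, card_neighborFinset_eq_degree]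
        have := mt (hdeg u) hu
        omega
      have hzN : z ∈ G.neighborFinset u := by simpa using hadj.symm
      rw [← eq_of_subset_of_card_le hsub hle] at hzN
      exact hzW (mem_insert_of_mem hzN)
  · intro y hy hdy
    have hyc : y = c := by
      by_contra h
      exact hy (mem_insert_of_mem (mem_erase.2 ⟨h, hdeg y hdy⟩))
    exact ⟨w, hwmem, hyc ▸ hwc.symm⟩

lemma exists_isGoodSet_of_lt (hg : 8 ≤ G.egirth) (hlt : mParam G < (denseSet G).card) :
    ∃ W, IsGoodSet G W := by
  classical
  obtain ⟨W, hDW, hWM, hcard⟩ := exists_subsuperset_card_eq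
    (s := univ.filter fun v => mParam G ≤ G.degree v) (t := denseSet G)
    (fun v hv => mem_denseSet.2 ((Nat.sub_le _ _).trans (by simpa using hv)))
    (card_filter_mParam_le_degree G) hlt.le
  have hdeg : ∀ x, mParam G ≤ G.degree x → x ∈ W := fun x hx => hDW (by simpa using hx)
  have hdense : ∀ v ∈ W, mParam G - 1 ≤ G.degree v := fun v hv => mem_denseSet.1 (hWM hv)
  by_cases hgood : ∃ u, u ∉ W ∧ Encircles G W u
  swap
  · push Not at hgood
    exact ⟨W, hcard, hdense, hgood, fun x hx hdx => (hx (hdeg x hdx)).elim⟩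
  obtain ⟨u, hu, henc⟩ := hgood
  obtain ⟨w, hw, c, hc, w', hw', hne, huw, hwc, huw', hdw⟩ := henc.exists_parent hu hcard hdeg
  obtain ⟨x, hx, hxW⟩ := exists_mem_notMem_of_card_lt_card (hcard ▸ hlt)
  rw [mem_denseSet] at hx
  by_cases hall : ∀ v ∈ W, G.Adj u v ∨ G.Adj w v
  · by_cases hxu : x = u
    · exact ⟨_, isGoodSet_exchange_child hg hu hcard hdense hdeg hw hc hw' hne huw hwc
        huw' (hxu ▸ hx) hall⟩
    · exact ⟨_, isGoodSet_exchange_parent hg hu hcard hdense hdeg hw hc hw' hne huw hwc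
        huw' hdw hx hxW fun h => (hxu h).elim⟩
  · refine ⟨_, isGoodSet_exchange_parent hg hu hcard hdense hdeg hw hc hw' hne huw hwc
      huw' hdw hx hxW fun _ h => ?_⟩
    push Not at hall
    obtain ⟨v, hv, huv, hwv⟩ := hall
    obtain ⟨p, -, hvp, hup, -⟩ := (henc v hv).resolve_left huv
    have hvw : v ≠ w := by rintro rfl; exact huv huw
    have hvu : v ≠ u := fun h => hu (h ▸ hv)
    rcases h v (mem_insert_of_mem (mem_erase.2 ⟨hvw, hv⟩)) with h | ⟨a, -, hva, hwa, -⟩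
    · exact hwv h
    · exact no_closed_walk_five hg hva hwa.symm huw.symm hup hvp.symm

end MParam

/-- For a graph of girth at least 8, `G` has no good set if and only if `|M(G)| = m(G)`
and `M(G)` encircles some vertex outside `M(G)`. -/
theorem no_goodSet_iff {V : Type*} [Fintype V] (G : SimpleGraph V) [DecidableRel G.Adj]
    (hg : 8 ≤ G.egirth) :
    (¬ ∃ W : Finset V, IsGoodSet G W) ↔
      ((denseSet G).card = mParam G ∧
        ∃ u, u ∉ denseSet G ∧ Encircles G (denseSet G) u) := by
  constructor
  · intro hno
    have hcard : (denseSet G).card = mParam G := by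
      refine le_antisymm ?_ (mParam_le_card_denseSet G)
      by_contra! hlt
      exact hno (exists_isGoodSet_of_lt hg hlt)
    refine ⟨hcard, ?_⟩
    by_contra! hu
    exact hno ⟨denseSet G, hcard, fun v hv => mem_denseSet.1 hv, hu, fun x hx hdx =>
      (hx (mem_denseSet.2 ((Nat.sub_le _ _).trans hdx))).elim⟩
  · rintro ⟨hcard, u, hu, henc⟩ ⟨W, hW, hdense, hnot, -⟩
    have hWM : W = denseSet G :=
      eq_of_subset_of_card_le (fun v hv => mem_denseSet.2 (hdense v hv)) (by omega)
    subst hWM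
    exact hnot u hu henc
end
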